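/- arXiv:1703.10063 — 6 statements merged into one kernel-verified Lean document; each statement's English description precedes it below -/
import Mathlib

section
/- Let C be a unital C*-algebra, let 𝒜 ⊆ C be a closed subalgebra, and let † : 𝒜 → 𝒜 be a completely isometric involution. Define π : 𝒜 → M₂(C) by π(a) = [[a, 0],[0, (a†)*]] and let u = [[0,1],[1,0]] ∈ M₂(C). Then u is a self-adjoint unitary in M₂(C), π is an injective algebra homomorphism which is completely isometric, i.e. for every n ≥ 1 and every matrix a = (a_{ij}) ∈ Mₙ(𝒜) one has ‖(π(a_{ij}))_{ij}‖ in Mₙ(M₂(C)) equal to ‖(a_{ij})_{ij}‖ in Mₙ(C), and π(a)* = u·π(a†)·u for every a ∈ 𝒜. -/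
open scoped ComplexConjugate

/-- A family of norms realizing, for every finite index type `m`, the unique C*-algebra norm
on the matrix algebra `Matrix m m C` over the C*-algebra `C`: it is a complete, submultiplicative
norm satisfying the C*-identity and agreeing with the norm of `C` on `1 × 1` matrices. -/
structure IsCStarMatrixNorm (C : Type*) [NonUnitalNormedRing C] [StarRing C] [NormedSpace ℂ C]
    (ν : ∀ (m : Type) [Fintype m] [DecidableEq m], Matrix m m C → ℝ) : Prop where
  eq_zero : ∀ (m : Type) [Fintype m] [DecidableEq m] (x : Matrix m m C), ν m x = 0 → x = 0
  add_le : ∀ (m : Type) [Fintype m] [DecidableEq m] (x y : Matrix m m C),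
    ν m (x + y) ≤ ν m x + ν m y
  smul_eq : ∀ (m : Type) [Fintype m] [DecidableEq m] (c : ℂ) (x : Matrix m m C),
    ν m (c • x) = ‖c‖ * ν m x
  mul_le : ∀ (m : Type) [Fintype m] [DecidableEq m] (x y : Matrix m m C),
    ν m (x * y) ≤ ν m x * ν m y
  star_mul_self : ∀ (m : Type) [Fintype m] [DecidableEq m] (x : Matrix m m C),
    ν m (star x * x) = ν m x ^ 2
  norm_def : ∀ a : C, ν (Fin 1) (Matrix.of fun _ _ => a) = ‖a‖
  complete : ∀ (m : Type) [Fintype m] [DecidableEq m] (u : ℕ → Matrix m m C),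
    (∀ ε : ℝ, 0 < ε → ∃ N : ℕ, ∀ p ≥ N, ∀ q ≥ N, ν m (u p - u q) < ε) →
    ∃ x : Matrix m m C, ∀ ε : ℝ, 0 < ε → ∃ N : ℕ, ∀ p ≥ N, ν m (u p - x) < ε

namespace IsCStarMatrixNorm

variable {C : Type*} [NonUnitalCStarAlgebra C]
  {ν : ∀ (m : Type) [Fintype m] [DecidableEq m], Matrix m m C → ℝ}

theorem map_zero (hν : IsCStarMatrixNorm C ν) (m : Type) [Fintype m] [DecidableEq m] :
    ν m 0 = 0 := by
  simpa using hν.smul_eq m 0 0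

theorem nonneg (hν : IsCStarMatrixNorm C ν) (m : Type) [Fintype m] [DecidableEq m]
    (x : Matrix m m C) : 0 ≤ ν m x := by
  have h₁ := hν.add_le m x ((-1 : ℂ) • x)
  have h₂ := hν.smul_eq m (-1) x
  rw [h₂, neg_one_smul, add_neg_cancel, hν.map_zero, norm_neg, norm_one, one_mul] at h₁
  linarith

theorem normedSpaceCore (hν : IsCStarMatrixNorm C ν) (m : Type) [Fintype m] [DecidableEq m] :
    letI : Norm (Matrix m m C) := ⟨ν m⟩
    NormedSpace.Core ℂ (Matrix m m C) :=
  letI : Norm (Matrix m m C) := ⟨ν m⟩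
  { norm_nonneg := hν.nonneg m
    norm_smul := hν.smul_eq m
    norm_triangle := hν.add_le m
    norm_eq_zero_iff := fun x => ⟨hν.eq_zero m x, fun h => h ▸ hν.map_zero m⟩ }

/-- The C*-algebra structure on `Matrix m m C` whose norm is `ν m`. -/
@[reducible]
noncomputable def nonUnitalCStarAlgebra (hν : IsCStarMatrixNorm C ν)
    (m : Type) [Fintype m] [DecidableEq m] : NonUnitalCStarAlgebra (Matrix m m C) :=
  letI : Norm (Matrix m m C) := ⟨ν m⟩
  letI : NormedAddCommGroup (Matrix m m C) := .ofCore (hν.normedSpaceCore m)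
  letI : NormedSpace ℂ (Matrix m m C) := .ofCore (hν.normedSpaceCore m)
  letI : NonUnitalNormedRing (Matrix m m C) :=
    { (inferInstance : NonUnitalRing (Matrix m m C)),
      (inferInstance : NormedAddCommGroup (Matrix m m C)) with
      norm_mul_le := hν.mul_le m }
  { (inferInstance : NonUnitalNormedRing (Matrix m m C)),
    (inferInstance : NormedSpace ℂ (Matrix m m C)),
    (inferInstance : StarRing (Matrix m m C)) with
    complete := by
      refine (Metric.complete_of_cauchySeq_tendsto fun s hs => ?_).complete
      obtain ⟨x, hx⟩ := hν.complete m s fun ε hε => by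
        obtain ⟨N, hN⟩ := Metric.cauchySeq_iff.1 hs ε hε
        exact ⟨N, fun p hp q hq => (dist_eq_norm (s p) (s q)).ge.trans_lt (hN p hp q hq)⟩
      refine ⟨x, Metric.tendsto_atTop.2 fun ε hε => ?_⟩
      obtain ⟨N, hN⟩ := hx ε hε
      exact ⟨N, fun p hp => (dist_eq_norm (s p) x).le.trans_lt (hN p hp)⟩
    norm_mul_self_le := fun x => ((hν.star_mul_self m x).trans (sq _)).ge
    smul_assoc := smul_assoc
    smul_comm := smul_comm
    star_smul := star_smul }

theorem map_star (hν : IsCStarMatrixNorm C ν) (m : Type) [Fintype m] [DecidableEq m]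
    (x : Matrix m m C) : ν m (star x) = ν m x :=
  letI := hν.nonUnitalCStarAlgebra m
  norm_star x

theorem map_blockDiagonal (hν : IsCStarMatrixNorm C ν) (m o : Type) [Fintype m] [DecidableEq m]
    [Fintype o] [DecidableEq o] [Nonempty o] (x : o → Matrix m m C) (r : ℝ)
    (hx : ∀ k, ν m (x k) = r) : ν (m × o) (Matrix.blockDiagonal x) = r := by
  let := hν.nonUnitalCStarAlgebra m
  let := hν.nonUnitalCStarAlgebra (m × o)
  let φ : (o → Matrix m m C) →⋆ₙₐ[ℂ] Matrix (m × o) (m × o) C :=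
    { toFun := Matrix.blockDiagonal
      map_smul' := Matrix.blockDiagonal_smul
      map_zero' := Matrix.blockDiagonal_zero
      map_add' := Matrix.blockDiagonal_add
      map_mul' := Matrix.blockDiagonal_mul
      map_star' := fun y => (Matrix.blockDiagonal_conjTranspose y).symm }
  have h : ‖φ x‖ = ‖x‖ := NonUnitalStarAlgHom.norm_map φ Matrix.blockDiagonal_injective x
  have hr (k : o) : ‖x k‖ = r := hx k
  refine h.trans (le_antisymm ((pi_norm_le_iff_of_nonempty x).2 fun k => (hr k).le) ?_)
  obtain ⟨k⟩ := ‹Nonempty o›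
  exact (hr k).ge.trans (norm_le_pi_norm x k)

end IsCStarMatrixNorm

/-- **Standard form of an operator `*`-algebra inside `M₂(C)`.**
If `𝒜` is a closed subalgebra of a unital C*-algebra `C`, equipped with a completely isometric
involution `†`, then `π(a) := [[a, 0], [0, (a†)*]]` is an injective, completely isometric algebra
homomorphism `𝒜 → M₂(C)`, the matrix `u = [[0,1],[1,0]]` is a self-adjoint unitary, and
`π(a)* = u · π(a†) · u` for all `a ∈ 𝒜`. -/
theorem operator_star_algebra_standard_form_M2
    (C : Type*) [CStarAlgebra C]
    (ν : ∀ (m : Type) [Fintype m] [DecidableEq m], Matrix m m C → ℝ)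
    (hν : IsCStarMatrixNorm C ν)
    (A : NonUnitalSubalgebra ℂ C) (hA : IsClosed (A : Set C))
    (dag : C → C)
    (hdag_mem : ∀ a ∈ A, dag a ∈ A)
    (hdag_add : ∀ a ∈ A, ∀ b ∈ A, dag (a + b) = dag a + dag b)
    (hdag_smul : ∀ (c : ℂ), ∀ a ∈ A, dag (c • a) = conj c • dag a)
    (hdag_mul : ∀ a ∈ A, ∀ b ∈ A, dag (a * b) = dag b * dag a)
    (hdag_invol : ∀ a ∈ A, dag (dag a) = a)
    (hdag_iso : ∀ (n : ℕ) (x : Matrix (Fin n) (Fin n) C), (∀ i j, x i j ∈ A) →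
      ν (Fin n) (Matrix.of fun i j => dag (x j i)) = ν (Fin n) x)
    (π : C → Matrix (Fin 2) (Fin 2) C)
    (hπ : ∀ a, π a = !![a, 0; 0, star (dag a)])
    (u : Matrix (Fin 2) (Fin 2) C)
    (hu : u = !![0, 1; 1, 0]) :
    -- `u` is a self-adjoint unitary in `M₂(C)`
    star u = u ∧ u * u = 1 ∧
    -- `π` is injective on `𝒜`
    (∀ a ∈ A, ∀ b ∈ A, π a = π b → a = b) ∧
    -- `π` is an algebra homomorphism on `𝒜`
    (∀ a ∈ A, ∀ b ∈ A, π (a + b) = π a + π b) ∧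
    (∀ (c : ℂ), ∀ a ∈ A, π (c • a) = c • π a) ∧
    (∀ a ∈ A, ∀ b ∈ A, π (a * b) = π a * π b) ∧
    -- `π` is completely isometric: the norm of `(π(a_{ij}))_{ij}` in `Mₙ(M₂(C)) = M₂ₙ(C)`
    -- agrees with the norm of `(a_{ij})_{ij}` in `Mₙ(C)`
    (∀ (n : ℕ) (x : Matrix (Fin n) (Fin n) C), (∀ i j, x i j ∈ A) →
      ν (Fin n × Fin 2) (Matrix.of fun p q => π (x p.1 q.1) p.2 q.2) = ν (Fin n) x) ∧
    -- `u` implements the involution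
    (∀ a ∈ A, star (π a) = u * π (dag a) * u) := by
  subst hu
  refine ⟨?_, ?_, ?_, ?_, ?_, ?_, ?_, ?_⟩
  · ext i j
    fin_cases i <;> fin_cases j <;> simp [Matrix.star_apply]
  · ext i j
    fin_cases i <;> fin_cases j <;> simp [Matrix.mul_apply]
  · intro a _ b _ hab
    simpa [hπ] using congrFun₂ hab 0 0
  · intro a ha b hb
    simp [hπ, hdag_add a ha b hb]
  · intro c a ha
    simp [hπ, hdag_smul c a ha, star_smul]
  · intro a ha b hb
    simp [hπ, hdag_mul a ha b hb]
  · intro n x hx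
    have key := hν.map_blockDiagonal (Fin n) (Fin 2)
      ![x, star (Matrix.of fun i j => dag (x j i))] (ν (Fin n) x) (by
        intro k
        fin_cases k
        · rfl
        · exact (hν.map_star _ _).trans (hdag_iso n x hx))
    convert key using 2
    ext ⟨i, k⟩ ⟨j, l⟩
    fin_cases k <;> fin_cases l <;>
      simp [hπ, Matrix.blockDiagonal_apply, Matrix.star_apply]
  · intro a ha
    ext i j
    fin_cases i <;> fin_cases j <;>
      simp [hπ, Matrix.mul_apply, Matrix.star_apply, hdag_invol a ha]
end

section
/- Let A be a complex Banach space and for each t ∈ ℝ let τ_t : A → A be a ℂ-linear isometry. Let S := {z ∈ ℂ : |Im z| ≤ 1}. Suppose (fₙ) is a sequence of functions ℂ → A, each continuous on S, complex-differentiable on the interior of S, and satisfying fₙ(z + t) = τ_t(fₙ(z)) for all z ∈ S and t ∈ ℝ. Suppose that the limits a = lim fₙ(0), b₊ = lim fₙ(i), b₋ = lim fₙ(−i) exist in A. Then there exists a function f : ℂ → A which is continuous on S, complex-differentiable on the interior of S, satisfies f(z + t) = τ_t(f(z)) for all z ∈ S and t ∈ ℝ, and such that f(0) = a, f(i) = b₊,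 f(−i) = b₋; in particular f(t) = τ_t(a) for all t ∈ ℝ. -/
open Filter Topology

/-- A function on the strip `|Im z| ≤ 1` whose norm is invariant under real translations is bounded
by its norms at `±i`. -/
theorem norm_le_max_of_norm_translation_invariant
    {A : Type*} [NormedAddCommGroup A] [NormedSpace ℂ A] {g : ℂ → A}
    (hc : ContinuousOn g (Complex.im ⁻¹' Set.Icc (-1) 1))
    (hd : DifferentiableOn ℂ g (Complex.im ⁻¹' Set.Ioo (-1) 1))
    (ht : ∀ z ∈ Complex.im ⁻¹' Set.Icc (-1) 1, ∀ t : ℝ, ‖g (z + t)‖ = ‖g z‖)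
    {z : ℂ} (hz : z ∈ Complex.im ⁻¹' Set.Icc (-1) 1) :
    ‖g z‖ ≤ max ‖g Complex.I‖ ‖g (-Complex.I)‖ := by
  have key : ∀ w ∈ Complex.im ⁻¹' Set.Icc (-1) 1, ‖g w‖ = ‖g (w.im * Complex.I)‖ := by
    intro w hw
    rw [← ht (w.im * Complex.I) (by simpa using hw) w.re, add_comm, Complex.re_add_im]
  have hline : ContinuousOn (fun y : ℝ => g (y * Complex.I)) (Set.Icc (-1) 1) :=
    hc.comp (by fun_prop) fun y hy => by simpa using hy
  obtain ⟨M, hM⟩ := isCompact_Icc.exists_bound_of_continuousOn hline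
  refine PhragmenLindelof.horizontal_strip (a := -1) (b := 1) ⟨hd, ?_⟩
    ⟨0, by positivity, 0, ?_⟩ ?_ ?_ hz.1 hz.2
  · rwa [Complex.closure_preimage_im, closure_Ioo (by norm_num)]
  · refine Asymptotics.IsBigO.of_bound M ?_
    refine Filter.mem_inf_of_right fun w hw => ?_
    have hw' : w ∈ Complex.im ⁻¹' Set.Icc (-1) 1 := Set.Ioo_subset_Icc_self hw
    simpa [key w hw'] using hM w.im hw'
  · intro w hw
    rw [key w (by simp [hw]), hw]
    simp
  · intro w hw
    rw [key w (by simp [hw]), hw]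
    simp

/-- **Closedness of the analytic extension for a one-parameter group of isometries.**
Let `A` be a complex Banach space, `τ t : A → A` linear isometries for `t ∈ ℝ`, and
`S = {z : ℂ | |Im z| ≤ 1}`. Suppose `fₙ : ℂ → A` are continuous on `S`, complex-differentiable
on the interior of `S`, equivariant (`fₙ(z + t) = τ t (fₙ z)`), and that `fₙ(0) → a`,
`fₙ(i) → b₊` and `fₙ(-i) → b₋`. Then there is a function `f` with the same continuity,
differentiability and equivariance properties such that `f 0 = a`, `f i = b₊`, `f (-i) = b₋`;
in particular `f t = τ t a` for all real `t`. -/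
theorem analytic_elements_closedness
    (A : Type*) [NormedAddCommGroup A] [NormedSpace ℂ A] [CompleteSpace A]
    (τ : ℝ → A →ₗᵢ[ℂ] A)
    (S : Set ℂ) (hS : S = {z : ℂ | |z.im| ≤ 1})
    (f : ℕ → ℂ → A)
    (hf_cont : ∀ n, ContinuousOn (f n) S)
    (hf_diff : ∀ n, DifferentiableOn ℂ (f n) (interior S))
    (hf_equiv : ∀ n, ∀ z ∈ S, ∀ t : ℝ, f n (z + (t : ℂ)) = τ t (f n z))
    (a bp bm : A)
    (ha : Tendsto (fun n => f n 0) atTop (𝓝 a))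
    (hbp : Tendsto (fun n => f n Complex.I) atTop (𝓝 bp))
    (hbm : Tendsto (fun n => f n (-Complex.I)) atTop (𝓝 bm)) :
    ∃ g : ℂ → A,
      ContinuousOn g S ∧
      DifferentiableOn ℂ g (interior S) ∧
      (∀ z ∈ S, ∀ t : ℝ, g (z + (t : ℂ)) = τ t (g z)) ∧
      g 0 = a ∧ g Complex.I = bp ∧ g (-Complex.I) = bm ∧
      (∀ t : ℝ, g (t : ℂ) = τ t a) := by
  have hS' : S = Complex.im ⁻¹' Set.Icc (-1) 1 := by
    ext z
    simp [hS, abs_le]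
  have hint : interior S = Complex.im ⁻¹' Set.Ioo (-1) 1 := by
    rw [hS', Complex.interior_preimage_im, interior_Icc]
  have h0 : (0 : ℂ) ∈ S := by simp [hS]
  have hI : Complex.I ∈ S := by simp [hS]
  have hI' : -Complex.I ∈ S := by simp [hS]
  have bound : ∀ m n, ∀ z ∈ S, dist (f m z) (f n z) ≤
      max (dist (f m Complex.I) (f n Complex.I)) (dist (f m (-Complex.I)) (f n (-Complex.I))) := by
    intro m n z hz
    simp only [dist_eq_norm]
    refine norm_le_max_of_norm_translation_invariant (g := fun w => f m w - f n w)
      (hS' ▸ (hf_cont m).sub (hf_cont n)) (hint ▸ (hf_diff m).sub (hf_diff n)) ?_ (hS' ▸ hz)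
    intro w hw t
    rw [← hS'] at hw
    rw [hf_equiv m w hw, hf_equiv n w hw, ← map_sub, LinearIsometry.norm_map]
  have cauchy : UniformCauchySeqOn f atTop S := by
    rw [Metric.uniformCauchySeqOn_iff]
    intro ε hε
    obtain ⟨N₁, hN₁⟩ := Metric.cauchySeq_iff.1 hbp.cauchySeq ε hε
    obtain ⟨N₂, hN₂⟩ := Metric.cauchySeq_iff.1 hbm.cauchySeq ε hε
    refine ⟨max N₁ N₂, fun m hm n hn z hz => (bound m n z hz).trans_lt (max_lt ?_ ?_)⟩
    · exact hN₁ m (le_of_max_le_left hm) n (le_of_max_le_left hn)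
    · exact hN₂ m (le_of_max_le_right hm) n (le_of_max_le_right hn)
  have lim : ∀ z, ∃ y, z ∈ S → Tendsto (fun n => f n z) atTop (𝓝 y) := by
    intro z
    by_cases hz : z ∈ S
    · obtain ⟨y, hy⟩ := cauchySeq_tendsto_of_complete (cauchy.cauchySeq hz)
      exact ⟨y, fun _ => hy⟩
    · exact ⟨0, fun h => absurd h hz⟩
  choose g hg using lim
  have unif : TendstoUniformlyOn f g atTop S := cauchy.tendstoUniformlyOn_of_tendsto hg
  have equiv : ∀ z ∈ S, ∀ t : ℝ, g (z + (t : ℂ)) = τ t (g z) := by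
    intro z hz t
    have hzt : z + (t : ℂ) ∈ S := by simpa [hS] using hz
    refine tendsto_nhds_unique (hg _ hzt) ?_
    simp only [hf_equiv _ z hz t]
    exact ((τ t).continuous.tendsto _).comp (hg z hz)
  have g0 : g 0 = a := tendsto_nhds_unique (hg 0 h0) ha
  refine ⟨g, unif.continuousOn (Frequently.of_forall hf_cont), ?_, equiv, g0,
    tendsto_nhds_unique (hg _ hI) hbp, tendsto_nhds_unique (hg _ hI') hbm, fun t => ?_⟩
  · exact (unif.mono interior_subset).tendstoLocallyUniformlyOn.differentiableOn
      (Eventually.of_forall hf_diff) isOpen_interior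
  · simpa [g0] using equiv 0 h0 t
end

section
/- Let ι be a type and let F = FreeGroup ι be the free group on generators {of j : j ∈ ι}. There is a unique group homomorphism σ : F → F with σ(of j) = (of j)⁻¹ for every j ∈ ι, and it satisfies σ∘σ = id (so σ is an automorphism of order two). Moreover, on the Hilbert space ℓ²(F), let U_g (for g ∈ F) be the unitary determined by U_g δ_τ = δ_{gτ} and let W be the operator determined by W δ_τ = δ_{σ(τ)}. Then W is a self-adjoint unitary, W U_g W = U_{σ(g)} for all g ∈ F, and W U_{of j}* W = U_{of j} for every j ∈ ι. -/
open scoped ENNReal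

namespace lp

/-- Bounded operators on `ℓ²(α)` that agree on the standard basis are equal. -/
theorem continuousLinearMap_ext_single_one {α E : Type*} [DecidableEq α]
    [NormedAddCommGroup E] [NormedSpace ℂ E]
    {S T : lp (fun _ : α => ℂ) 2 →L[ℂ] E}
    (h : ∀ i, S (lp.single 2 i (1 : ℂ)) = T (lp.single 2 i (1 : ℂ))) : S = T := by
  refine lp.ext_continuousLinearMap ENNReal.ofNat_ne_top fun i => ?_
  ext
  exact h i

/-- The adjoint of an operator permuting the standard basis of `ℓ²(α)` permutes it by the inverse
permutation. -/
theorem adjoint_apply_single_one {α : Type*} [DecidableEq α]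
    {T : lp (fun _ : α => ℂ) 2 →L[ℂ] lp (fun _ : α => ℂ) 2} (e : Equiv.Perm α)
    (h : ∀ i, T (lp.single 2 i (1 : ℂ)) = lp.single 2 (e i) (1 : ℂ)) (i : α) :
    ContinuousLinearMap.adjoint T (lp.single 2 i (1 : ℂ)) = lp.single 2 (e.symm i) (1 : ℂ) := by
  ext j
  have key := ContinuousLinearMap.adjoint_inner_right T (lp.single 2 j (1 : ℂ))
    (lp.single 2 i (1 : ℂ))
  rw [h, lp.inner_single_left, lp.inner_single_left] at key
  simpa [Pi.single_apply, Equiv.eq_symm_apply] using key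

end lp

/-- **The symmetry on `ℓ²` of a free group induced by inverting the generators.**
There is a unique group homomorphism `σ` of the free group `F = FreeGroup ι` with
`σ (of j) = (of j)⁻¹`, it has order two, and if `U g` are the translation unitaries on `ℓ²(F)`
(`U g δ_τ = δ_{gτ}`) and `W` is determined by `W δ_τ = δ_{σ τ}`, then `W` is a self-adjoint
unitary with `W (U g) W = U (σ g)` for all `g ∈ F` and `W (U (of j))* W = U (of j)` for all
generators `j`. -/
theorem free_group_generator_inversion_symmetry
    (ι : Type) [DecidableEq ι] (σ : FreeGroup ι →* FreeGroup ι)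
    (hσ : ∀ j : ι, σ (FreeGroup.of j) = (FreeGroup.of j)⁻¹)
    (U : FreeGroup ι → (lp (fun _ : FreeGroup ι => ℂ) 2 →L[ℂ] lp (fun _ : FreeGroup ι => ℂ) 2))
    (hU : ∀ (g τ : FreeGroup ι), U g (lp.single 2 τ (1 : ℂ)) = lp.single 2 (g * τ) (1 : ℂ))
    (W : lp (fun _ : FreeGroup ι => ℂ) 2 →L[ℂ] lp (fun _ : FreeGroup ι => ℂ) 2)
    (hW : ∀ τ : FreeGroup ι, W (lp.single 2 τ (1 : ℂ)) = lp.single 2 (σ τ) (1 : ℂ)) :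
    -- existence and uniqueness of `σ`
    (∃! σ' : FreeGroup ι →* FreeGroup ι, ∀ j : ι, σ' (FreeGroup.of j) = (FreeGroup.of j)⁻¹) ∧
    -- `σ` has order two
    σ.comp σ = MonoidHom.id (FreeGroup ι) ∧
    -- `W` is a self-adjoint unitary
    ContinuousLinearMap.adjoint W = W ∧
    W ∘L W = 1 ∧
    -- `W` intertwines the translation unitaries along `σ`
    (∀ g : FreeGroup ι, W ∘L U g ∘L W = U (σ g)) ∧
    -- `W` implements the involution on the generators
    (∀ j : ι, W ∘L ContinuousLinearMap.adjoint (U (FreeGroup.of j)) ∘L W = U (FreeGroup.of j)) := by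
  have hσσ : σ.comp σ = MonoidHom.id (FreeGroup ι) :=
    FreeGroup.ext_hom _ _ fun j => by simp [hσ]
  have hinv : Function.Involutive σ := fun g => DFunLike.congr_fun hσσ g
  refine ⟨⟨σ, hσ, fun σ' h => FreeGroup.ext_hom _ _ fun j => by rw [h, hσ]⟩, hσσ, ?_, ?_, ?_, ?_⟩
  · refine lp.continuousLinearMap_ext_single_one fun τ => ?_
    rw [lp.adjoint_apply_single_one hinv.toPerm hW, hW]
    rfl
  · refine lp.continuousLinearMap_ext_single_one fun τ => ?_
    simp [hW, hinv τ]
  · refine fun g => lp.continuousLinearMap_ext_single_one fun τ => ?_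
    simp [hW, hU, hinv τ]
  · refine fun j => lp.continuousLinearMap_ext_single_one fun τ => ?_
    have hadj := lp.adjoint_apply_single_one (Equiv.mulLeft (FreeGroup.of j)) (hU (FreeGroup.of j))
    simp [hW, hU, hadj, hσ, hinv τ]
end

section
/- Let C be a C*-algebra, let ℬ ⊆ C be a closed subalgebra, and let † : ℬ → ℬ be a completely isometric involution. Let ℒ ⊆ ℬ be a closed right ideal (ℒ is a closed subspace with ℒ·ℬ ⊆ ℒ), and let 𝒜 ⊆ ℬ be the closed linear span of {ξ·η† : ξ, η ∈ ℒ}. Then: (i) 𝒜 is a closed subalgebra of ℬ with {a† : a ∈ 𝒜} = 𝒜 and 𝒜·ℒ ⊆ ℒ; (ii) the pairing ⟨ξ, η⟩ := ξ†·η ∈ ℬ satisfies ⟨ξ, η·b⟩ = ⟨ξ, η⟩·b, ⟨ξ, η⟩† = ⟨η, ξ⟩, and ⟨a·ξ, η⟩ = ⟨ξ, a†·η⟩ for all ξ, η ∈ ℒ, b ∈ ℬ, a ∈ 𝒜; (iii) the matrix Cauchy–Schwarz inequality holds: for every n ≥ 1 and all ξ = (ξ_{ij}), η = (η_{ij}) ∈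 Mₙ(ℒ), the matrix with (i,j)-entry Σ_k ξ_{ki}†·η_{kj} has norm at most ‖ξ‖·‖η‖ in Mₙ(C). -/
open scoped ComplexConjugate

/-- **Closed right ideals of operator `*`-algebras are operator `*`-correspondences.**
Let `ℬ` be a closed subalgebra of a C*-algebra `C` with a completely isometric involution `†`,
let `ℒ ⊆ ℬ` be a closed right ideal and `𝒜` the closed span of `{ξ·η† : ξ, η ∈ ℒ}`. Then `𝒜`
is a closed `†`-invariant subalgebra with `𝒜·ℒ ⊆ ℒ`, the pairing `⟨ξ, η⟩ = ξ†·η` is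
`ℬ`-linear, `†`-hermitian and `𝒜`-adjointable, and the matrix Cauchy–Schwarz inequality
holds. -/
theorem closed_right_ideal_operator_star_correspondence
    (C : Type*) [CStarAlgebra C]
    (ν : ∀ (m : Type) [Fintype m] [DecidableEq m], Matrix m m C → ℝ)
    (hν : IsCStarMatrixNorm C ν)
    (B : NonUnitalSubalgebra ℂ C) (hB : IsClosed (B : Set C))
    (dag : C → C)
    (hdag_mem : ∀ b ∈ B, dag b ∈ B)
    (hdag_add : ∀ a ∈ B, ∀ b ∈ B, dag (a + b) = dag a + dag b)
    (hdag_smul : ∀ (c : ℂ), ∀ b ∈ B, dag (c • b) = conj c • dag b)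
    (hdag_mul : ∀ a ∈ B, ∀ b ∈ B, dag (a * b) = dag b * dag a)
    (hdag_invol : ∀ b ∈ B, dag (dag b) = b)
    (hdag_iso : ∀ (n : ℕ) (x : Matrix (Fin n) (Fin n) C), (∀ i j, x i j ∈ B) →
      ν (Fin n) (Matrix.of fun i j => dag (x j i)) = ν (Fin n) x)
    -- `ℒ` is a closed right ideal of `ℬ`
    (L : Submodule ℂ C) (hL_closed : IsClosed (L : Set C))
    (hLB : (L : Set C) ⊆ (B : Set C))
    (hL_ideal : ∀ ξ ∈ L, ∀ b ∈ B, ξ * b ∈ L)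
    -- `𝒜` is the closed linear span of `{ξ·η† : ξ, η ∈ ℒ}`
    (A : Submodule ℂ C)
    (hA : A = (Submodule.span ℂ {z : C | ∃ ξ ∈ L, ∃ η ∈ L, z = ξ * dag η}).topologicalClosure) :
    -- (i) `𝒜` is a closed `†`-invariant subalgebra of `ℬ` with `𝒜·ℒ ⊆ ℒ`
    IsClosed (A : Set C) ∧
    (A : Set C) ⊆ (B : Set C) ∧
    (∀ a ∈ A, ∀ a' ∈ A, a * a' ∈ A) ∧
    dag '' (A : Set C) = (A : Set C) ∧
    (∀ a ∈ A, ∀ ξ ∈ L, a * ξ ∈ L) ∧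
    -- (ii) properties of the pairing `⟨ξ, η⟩ = ξ†·η`
    (∀ ξ ∈ L, ∀ η ∈ L, dag ξ * η ∈ B) ∧
    (∀ ξ ∈ L, ∀ η ∈ L, ∀ b ∈ B, dag ξ * (η * b) = (dag ξ * η) * b) ∧
    (∀ ξ ∈ L, ∀ η ∈ L, dag (dag ξ * η) = dag η * ξ) ∧
    (∀ a ∈ A, ∀ ξ ∈ L, ∀ η ∈ L, dag (a * ξ) * η = dag ξ * (dag a * η)) ∧
    -- (iii) the matrix Cauchy–Schwarz inequality
    (∀ (n : ℕ) (ξ η : Matrix (Fin n) (Fin n) C),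
      (∀ i j, ξ i j ∈ L) → (∀ i j, η i j ∈ L) →
      ν (Fin n) (Matrix.of fun i j => ∑ k, dag (ξ k i) * η k j) ≤
        ν (Fin n) ξ * ν (Fin n) η) := by
  set S : Set C := {z : C | ∃ ξ ∈ L, ∃ η ∈ L, z = ξ * dag η} with hS
  have hA_closed : IsClosed (A : Set C) := by
    rw [hA]; exact Submodule.isClosed_topologicalClosure _
  have hSA : S ⊆ A := by
    rw [hA]
    exact Submodule.subset_span.trans (Submodule.le_topologicalClosure _)
  have hA_le : ∀ P : Submodule ℂ C, IsClosed (P : Set C) → S ⊆ P → A ≤ P := fun P hP hSP ↦ by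
    rw [hA]
    exact Submodule.topologicalClosure_minimal _ (Submodule.span_le.2 hSP) hP
  have hSB : S ⊆ B := by
    rintro _ ⟨ξ, hξ, η, hη, rfl⟩
    exact B.mul_mem (hLB hξ) (hdag_mem _ (hLB hη))
  have hAB : ∀ a ∈ A, a ∈ B := hA_le B.toSubmodule hB hSB
  have hAL : ∀ a ∈ A, ∀ ξ ∈ L, a * ξ ∈ L := by
    intro a ha ξ hξ
    refine hA_le (L.comap (LinearMap.mulRight ℂ ξ))
      (hL_closed.preimage (continuous_mul_const ξ)) ?_ ha
    rintro _ ⟨ζ, hζ, η, hη, rfl⟩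
    change ζ * dag η * ξ ∈ L
    rw [mul_assoc]
    exact hL_ideal _ hζ _ (B.mul_mem (hdag_mem _ (hLB hη)) (hLB hξ))
  have hAA : ∀ a ∈ A, ∀ a' ∈ A, a * a' ∈ A := by
    intro a ha a' ha'
    refine hA_le (A.comap (LinearMap.mulLeft ℂ a))
      (hA_closed.preimage (continuous_const_mul a)) ?_ ha'
    rintro _ ⟨ζ, hζ, η, hη, rfl⟩
    exact hSA ⟨a * ζ, hAL a ha ζ hζ, η, hη, (mul_assoc _ _ _).symm⟩
  have hdag_norm : ∀ b ∈ B, ‖dag b‖ = ‖b‖ := fun b hb ↦ by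
    rw [← hν.norm_def, ← hν.norm_def]
    exact hdag_iso 1 (Matrix.of fun _ _ ↦ b) fun _ _ ↦ hb
  have hdag_sub : ∀ a ∈ B, ∀ b ∈ B, dag (a - b) = dag a - dag b := fun a ha b hb ↦ by
    have h := hdag_add (a - b) (B.sub_mem ha hb) b hb
    rw [sub_add_cancel] at h
    rw [h, add_sub_cancel_right]
  have hdag_cont : ContinuousOn dag B := by
    refine (LipschitzOnWith.of_dist_le_mul (K := 1) fun a ha b hb ↦ ?_).continuousOn
    rw [dist_eq_norm, dist_eq_norm, ← hdag_sub a ha b hb, hdag_norm _ (B.sub_mem ha hb),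
      NNReal.coe_one, one_mul]
  have hspanB : ∀ a ∈ Submodule.span ℂ S, a ∈ B :=
    (Submodule.span_le (p := B.toSubmodule)).2 hSB
  have hdag_span : ∀ a ∈ Submodule.span ℂ S, dag a ∈ Submodule.span ℂ S := by
    intro a ha
    induction ha using Submodule.span_induction with
    | mem x hx =>
      obtain ⟨ξ, hξ, η, hη, rfl⟩ := hx
      refine Submodule.subset_span ⟨η, hη, ξ, hξ, ?_⟩
      rw [hdag_mul _ (hLB hξ) _ (hdag_mem _ (hLB hη)), hdag_invol _ (hLB hη)]
    | zero =>
      have h := hdag_smul 0 0 B.zero_mem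
      rw [map_zero, zero_smul, zero_smul] at h
      rw [h]
      exact zero_mem _
    | add x y hx hy hx' hy' =>
      rw [hdag_add _ (hspanB x hx) _ (hspanB y hy)]
      exact add_mem hx' hy'
    | smul c x hx hx' =>
      rw [hdag_smul c _ (hspanB x hx)]
      exact Submodule.smul_mem _ _ hx'
  have hA_coe : (A : Set C) = closure (Submodule.span ℂ S : Set C) := by
    rw [hA, Submodule.topologicalClosure_coe]
  have hdagA : ∀ a ∈ A, dag a ∈ A := by
    have h : Set.MapsTo dag (closure (Submodule.span ℂ S : Set C))
        (closure (Submodule.span ℂ S : Set C)) :=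
      Set.MapsTo.closure_of_continuousOn hdag_span
        (hdag_cont.mono (hA_coe ▸ hAB))
    rwa [← hA_coe] at h
  refine ⟨hA_closed, hAB, hAA, ?_, hAL, ?_, ?_, ?_, ?_, ?_⟩
  · refine Set.Subset.antisymm (Set.image_subset_iff.2 hdagA) fun a ha ↦ ?_
    exact ⟨dag a, hdagA a ha, hdag_invol a (hAB a ha)⟩
  · exact fun ξ hξ η hη ↦ B.mul_mem (hdag_mem _ (hLB hξ)) (hLB hη)
  · exact fun ξ _ η _ b _ ↦ (mul_assoc _ _ _).symm
  · intro ξ hξ η hη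
    rw [hdag_mul _ (hdag_mem _ (hLB hξ)) _ (hLB hη), hdag_invol _ (hLB hξ)]
  · intro a ha ξ hξ η _
    rw [hdag_mul _ (hAB a ha) _ (hLB hξ), mul_assoc]
  · intro n ξ η hξ _
    rw [← hdag_iso n ξ fun i j ↦ hLB (hξ i j)]
    exact hν.mul_le (Fin n) (Matrix.of fun i j ↦ dag (ξ j i)) η
end

section
/- Let H and K be complex Hilbert spaces, let 𝒜 be a complex associative algebra equipped with an involution a ↦ a† (conjugate-linear, anti-multiplicative, (a†)† = a), and let X be a left 𝒜-module. Suppose given functions α : 𝒜 → B(K), r : X → B(K), s : X → B(K), ψ : X × X → B(H), and bounded operators S : K → H and T : H → K such that for all a ∈ 𝒜 and x, y ∈ X: (i) S∘s(x)∘r(y)∘T = ψ(x, y); (ii) s(x)∘α(a) = s(a†·x); (iii) ψ(a†·x, y) = ψ(x, a·y). Let E ⊆ K be the closed linear span of {s(x)*(S*h) : x ∈ X, h ∈ H}, let P ∈ B(K) be the orthogonal projection onto E, let F ⊆ K be the closed linear span of {P(r(x)(Th)) : x ∈ X, h ∈ H}, and let Q ∈ B(K) be the orthogonal projection onto F. Then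 for all a ∈ 𝒜 and x ∈ X: P∘Q = Q∘P = Q; P∘α(a)∘P = P∘α(a); Q∘α(a)∘P = Q∘α(a); Q∘r(x)∘T = P∘r(x)∘T; S∘s(x)∘P = S∘s(x); P∘α(a)∘P∘r(x)∘T = P∘r(a·x)∘T; and Q∘α(a)∘Q = P∘α(a)∘Q. -/
open scoped ComplexConjugate
open ContinuousLinearMap

/-- An idempotent with range `E` fixes `E` pointwise. -/
theorem ContinuousLinearMap.apply_eq_self_of_range_eq {K : Type*} [NormedAddCommGroup K]
    [InnerProductSpace ℂ K] {P : K →L[ℂ] K} {E : Submodule ℂ K} (hP_idem : P ∘L P = P)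
    (hP_range : Set.range P = (E : Set K)) {v : K} (hv : v ∈ E) : P v = v := by
  rw [← SetLike.mem_coe, ← hP_range] at hv
  obtain ⟨w, rfl⟩ := hv
  exact DFunLike.congr_fun hP_idem w

/-- A bounded operator mapping a set into a closed submodule maps its closed span there. -/
theorem ContinuousLinearMap.map_mem_of_mem_closedSpan {K L : Type*} [NormedAddCommGroup K]
    [InnerProductSpace ℂ K] [NormedAddCommGroup L] [InnerProductSpace ℂ L] (A : K →L[ℂ] L)
    {G : Set K} {M : Submodule ℂ L} (hM : IsClosed (M : Set L)) (hG : ∀ v ∈ G, A v ∈ M) {v : K}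
    (hv : v ∈ (Submodule.span ℂ G).topologicalClosure) : A v ∈ M :=
  Submodule.topologicalClosure_minimal (t := M.comap A.toLinearMap) _ (Submodule.span_le.2 hG)
    (hM.preimage A.continuous) hv

/-- A self-adjoint idempotent whose range is the closed span of `G` kills the vectors orthogonal
to `G`. -/
theorem ContinuousLinearMap.apply_eq_zero_of_inner_eq_zero {K : Type*} [NormedAddCommGroup K]
    [InnerProductSpace ℂ K] [CompleteSpace K] {P : K →L[ℂ] K} {G : Set K}
    (hP_sa : adjoint P = P) (hP_idem : P ∘L P = P)
    (hP_range : Set.range P = ((Submodule.span ℂ G).topologicalClosure : Set K)) {v : K}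
    (hv : ∀ w ∈ G, inner ℂ v w = 0) : P v = 0 := by
  have hPv : P v ∈ (Submodule.span ℂ G).topologicalClosure := by
    rw [← SetLike.mem_coe, ← hP_range]
    exact ⟨v, rfl⟩
  have h := (innerSL ℂ v).map_mem_of_mem_closedSpan (M := ⊥) isClosed_singleton
    (fun w hw => by simpa using hv w hw) hPv
  rw [Submodule.mem_bot, innerSL_apply_apply] at h
  have hPP : P (P v) = P v := DFunLike.congr_fun hP_idem v
  rw [← inner_self_eq_zero (𝕜 := ℂ), ← adjoint_inner_right, hP_sa, hPP, h]

/-- **Relations between the canonical projections in the Wittstock–Stinespring factorization.**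
Given Hilbert spaces `H`, `K`, an algebra `𝒜` with involution `†` acting on a module `X`,
maps `α : 𝒜 → B(K)`, `r, s : X → B(K)`, `ψ : X × X → B(H)` and bounded operators `S : K → H`,
`T : H → K` satisfying `S s(x) r(y) T = ψ(x,y)`, `s(x) α(a) = s(a†·x)` and
`ψ(a†·x, y) = ψ(x, a·y)`, the projections `P` (onto the closed span of `s(x)* S* H`) and `Q`
(onto the closed span of `P r(x) T H`) satisfy the listed relations. -/
theorem stinespring_projection_relations
    (H : Type*) [NormedAddCommGroup H] [InnerProductSpace ℂ H] [CompleteSpace H]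
    (K : Type*) [NormedAddCommGroup K] [InnerProductSpace ℂ K] [CompleteSpace K]
    (𝒜 : Type*) [Ring 𝒜] [Algebra ℂ 𝒜]
    (dag : 𝒜 → 𝒜)
    (hdag_add : ∀ a b, dag (a + b) = dag a + dag b)
    (hdag_smul : ∀ (c : ℂ) a, dag (c • a) = conj c • dag a)
    (hdag_mul : ∀ a b, dag (a * b) = dag b * dag a)
    (hdag_invol : ∀ a, dag (dag a) = a)
    (X : Type*) [AddCommGroup X] [Module 𝒜 X]
    (α : 𝒜 → (K →L[ℂ] K)) (r s : X → (K →L[ℂ] K)) (ψ : X → X → (H →L[ℂ] H))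
    (S : K →L[ℂ] H) (T : H →L[ℂ] K)
    (hfact : ∀ x y : X, S ∘L s x ∘L r y ∘L T = ψ x y)
    (hs : ∀ (a : 𝒜) (x : X), s x ∘L α a = s (dag a • x))
    (hψ : ∀ (a : 𝒜) (x y : X), ψ (dag a • x) y = ψ x (a • y))
    (E : Submodule ℂ K)
    (hE : E = (Submodule.span ℂ
      {v : K | ∃ (x : X) (h : H), v = adjoint (s x) (adjoint S h)}).topologicalClosure)
    (P : K →L[ℂ] K)
    (hP_sa : adjoint P = P) (hP_idem : P ∘L P = P) (hP_range : Set.range P = (E : Set K))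
    (F : Submodule ℂ K)
    (hF : F = (Submodule.span ℂ
      {v : K | ∃ (x : X) (h : H), v = P (r x (T h))}).topologicalClosure)
    (Q : K →L[ℂ] K)
    (hQ_sa : adjoint Q = Q) (hQ_idem : Q ∘L Q = Q) (hQ_range : Set.range Q = (F : Set K)) :
    (P ∘L Q = Q) ∧ (Q ∘L P = Q) ∧
    (∀ a : 𝒜, P ∘L α a ∘L P = P ∘L α a) ∧
    (∀ a : 𝒜, Q ∘L α a ∘L P = Q ∘L α a) ∧
    (∀ x : X, Q ∘L r x ∘L T = P ∘L r x ∘L T) ∧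
    (∀ x : X, S ∘L s x ∘L P = S ∘L s x) ∧
    (∀ (a : 𝒜) (x : X), P ∘L α a ∘L P ∘L r x ∘L T = P ∘L r (a • x) ∘L T) ∧
    (∀ a : 𝒜, Q ∘L α a ∘L Q = P ∘L α a ∘L Q) := by
  subst hE hF
  have hPE : ∀ v, P v ∈ (Submodule.span ℂ
      {v : K | ∃ (x : X) (h : H), v = adjoint (s x) (adjoint S h)}).topologicalClosure :=
    fun v => by rw [← SetLike.mem_coe, ← hP_range]; exact ⟨v, rfl⟩
  have hQF : ∀ v, Q v ∈ (Submodule.span ℂ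
      {v : K | ∃ (x : X) (h : H), v = P (r x (T h))}).topologicalClosure :=
    fun v => by rw [← SetLike.mem_coe, ← hQ_range]; exact ⟨v, rfl⟩
  have hP_ext : ∀ v w : K, (∀ x, S (s x v) = S (s x w)) → P v = P w := by
    intro v w hvw
    rw [← sub_eq_zero, ← map_sub]
    refine apply_eq_zero_of_inner_eq_zero hP_sa hP_idem hP_range ?_
    rintro _ ⟨x, h, rfl⟩
    rw [adjoint_inner_right, adjoint_inner_right, map_sub, map_sub, hvw, sub_self,
      inner_zero_left]
  have hSP : ∀ x v, S (s x (P v)) = S (s x v) := by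
    intro x v
    refine ext_inner_right ℂ fun h => ?_
    have hfix : P (adjoint (s x) (adjoint S h)) = adjoint (s x) (adjoint S h) :=
      apply_eq_self_of_range_eq hP_idem hP_range
        (Submodule.le_topologicalClosure _ (Submodule.subset_span ⟨x, h, rfl⟩))
    rw [← adjoint_inner_right, ← adjoint_inner_right, ← adjoint_inner_right, hP_sa, hfix,
      adjoint_inner_right, adjoint_inner_right]
  have hsα : ∀ a x v, s x (α a v) = s (dag a • x) v := fun a x v =>
    DFunLike.congr_fun (hs a x) v
  have hψ_apply : ∀ x y h, S (s x (r y (T h))) = ψ x y h := fun x y h =>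
    DFunLike.congr_fun (hfact x y) h
  have hPαP : ∀ a v, P (α a (P v)) = P (α a v) := fun a v =>
    hP_ext _ _ fun x => by rw [hsα, hsα, hSP]
  have hPαr : ∀ a x h, P (α a (P (r x (T h)))) = P (r (a • x) (T h)) := by
    intro a x h
    rw [hPαP]
    exact hP_ext _ _ fun y => by rw [hsα, hψ_apply, hψ_apply, hψ]
  have hPQ : P ∘L Q = Q := by
    ext v
    refine apply_eq_self_of_range_eq hP_idem hP_range ?_
    refine (ContinuousLinearMap.id ℂ K).map_mem_of_mem_closedSpan
      (Submodule.isClosed_topologicalClosure _) ?_ (hQF v)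
    rintro _ ⟨x, h, rfl⟩
    exact hPE _
  have hQP : Q ∘L P = Q := by
    have := congrArg adjoint hPQ
    rwa [adjoint_comp, hP_sa, hQ_sa] at this
  have hQP_apply : ∀ v, Q (P v) = Q v := DFunLike.congr_fun hQP
  have hQ_fix : ∀ v ∈ (Submodule.span ℂ
      {v : K | ∃ (x : X) (h : H), v = P (r x (T h))}).topologicalClosure, Q v = v :=
    fun v hv => apply_eq_self_of_range_eq hQ_idem hQ_range hv
  refine ⟨hPQ, hQP, fun a => ext fun v => hPαP a v, fun a => ext fun v => ?_,
    fun x => ext fun h => ?_, fun x => ext fun v => hSP x v,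
    fun a x => ext fun h => hPαr a x h, fun a => ext fun v => ?_⟩
  · change Q (α a (P v)) = Q (α a v)
    rw [← hQP_apply, hPαP, hQP_apply]
  · change Q (r x (T h)) = P (r x (T h))
    rw [← hQP_apply]
    exact hQ_fix _ (Submodule.le_topologicalClosure _ (Submodule.subset_span ⟨x, h, rfl⟩))
  · change Q (α a (Q v)) = P (α a (Q v))
    rw [← hQP_apply]
    refine hQ_fix _ ((P ∘L α a).map_mem_of_mem_closedSpan
      (Submodule.isClosed_topologicalClosure _) ?_ (hQF v))
    rintro _ ⟨x, h, rfl⟩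
    exact Submodule.le_topologicalClosure _ (Submodule.subset_span ⟨a • x, h, hPαr a x h⟩)
end

section
/- Let H₀ be a complex Hilbert space and let 𝒜, ℬ ⊆ B(H₀) be closed subalgebras each equipped with a completely isometric involution † (for every n ≥ 1, the dagger-transpose map (a_{ij}) ↦ (a_{ji}†) is isometric on Mₙ(𝒜), resp. Mₙ(ℬ), with the norms of Mₙ(B(H₀))). Let 𝒳 ⊆ B(H₀) be a closed subspace with 𝒜·𝒳 ⊆ 𝒳 and 𝒳·ℬ ⊆ 𝒳, equipped with a pairing ⟨·,·⟩ : 𝒳 × 𝒳 → ℬ which is conjugate-linear in the first and linear in the second variable and satisfies, for x, y ∈ 𝒳, a ∈ 𝒜, b ∈ ℬ: ⟨x, y·b⟩ = ⟨x,y⟩·b; ⟨x, y⟩ = ⟨y, x⟩†; ⟨a·x, y⟩ = ⟨x, a†·y⟩; and the matrix Cauchy–Schwarz inequality: for every n ≥ 1 and all ξ, η ∈ Mₙ(𝒳), the matrix with (i,j)-entry Σ_k ⟨ξ_{ki}, η_{kj}⟩ has norm at most ‖ξ‖·‖η‖. Then there exist a complex Hilbert space H_π, algebra homomorphisms π_𝒜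 : 𝒜 → B(H_π) and π_ℬ : ℬ → B(H_π), a linear map π_𝒳 : 𝒳 → B(H_π), and a self-adjoint unitary U ∈ B(H_π) such that: (1) π_𝒜 and π_ℬ are completely isometric, and for every n ≥ 1 and x ∈ Mₙ(𝒳), ‖x‖ ≤ ‖(π_𝒳(x_{ij}))_{ij}‖ ≤ √2·‖x‖; (2) π_𝒳(x·b) = π_𝒳(x)·π_ℬ(b) and π_𝒜(a)·π_𝒳(x) = π_𝒳(a·x); (3) U π_𝒜(a)* U = π_𝒜(a†) and U π_ℬ(b)* U = π_ℬ(b†); (4) U π_𝒳(x)* U π_𝒳(y) = π_ℬ(⟨x,y⟩), for all a ∈ 𝒜, b ∈ ℬ, x, y ∈ 𝒳. -/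
open scoped ComplexConjugate
open ContinuousLinearMap

/-- The bounded operator on the Hilbert space `ℓ²(m, H)` induced by a matrix of operators. -/
noncomputable def matOpCLM {H : Type*} [NormedAddCommGroup H] [InnerProductSpace ℂ H]
    {m : Type*} [Fintype m] (M : Matrix m m (H →L[ℂ] H)) :
    PiLp 2 (fun _ : m => H) →L[ℂ] PiLp 2 (fun _ : m => H) :=
  (((PiLp.continuousLinearEquiv 2 ℂ (fun _ : m => H)).symm :
      (m → H) →L[ℂ] PiLp 2 (fun _ : m => H)) ∘L
    (ContinuousLinearMap.pi fun i => ∑ j, (M i j) ∘L ContinuousLinearMap.proj j)) ∘L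
    ((PiLp.continuousLinearEquiv 2 ℂ (fun _ : m => H)) : PiLp 2 (fun _ : m => H) →L[ℂ] (m → H))

/-- The C*-norm of a matrix of bounded operators on the Hilbert space `H`, i.e. the norm of the
induced operator on `ℓ²(m, H)`. -/
noncomputable def opMatNorm {H : Type*} [NormedAddCommGroup H] [InnerProductSpace ℂ H]
    {m : Type*} [Fintype m] (M : Matrix m m (H →L[ℂ] H)) : ℝ :=
  ‖matOpCLM M‖

section MatBound

variable {ι κ τ E F G : Type*} [Fintype ι] [Fintype κ] [Fintype τ]
  [NormedAddCommGroup E] [InnerProductSpace ℂ E]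
  [NormedAddCommGroup F] [InnerProductSpace ℂ F]
  [NormedAddCommGroup G] [InnerProductSpace ℂ G]

/-- The operator from `ℓ²(κ, E)` to `ℓ²(ι, F)` induced by a matrix of operators has norm at
most `c`. -/
def MatBound (M : ι → κ → E →L[ℂ] F) (c : ℝ) : Prop :=
  ∀ h : κ → E, ∑ i, ‖∑ j, M i j (h j)‖ ^ 2 ≤ c ^ 2 * ∑ j, ‖h j‖ ^ 2

lemma matOpCLM_apply (M : Matrix ι ι (E →L[ℂ] E)) (h : PiLp 2 (fun _ : ι => E)) (i : ι) :
    matOpCLM M h i = ∑ j, M i j (h j) := by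
  simp [matOpCLM]

lemma opMatNorm_nonneg (M : Matrix ι ι (E →L[ℂ] E)) : 0 ≤ opMatNorm M :=
  norm_nonneg (matOpCLM M)

lemma opMatNorm_le_iff (M : Matrix ι ι (E →L[ℂ] E)) {c : ℝ} (hc : 0 ≤ c) :
    opMatNorm M ≤ c ↔ MatBound M c := by
  rw [opMatNorm, ContinuousLinearMap.opNorm_le_iff hc]
  constructor
  · intro H h
    have := H (WithLp.toLp 2 h)
    have h2 := pow_le_pow_left₀ (norm_nonneg _) this 2
    rw [mul_pow, PiLp.norm_sq_eq_of_L2, PiLp.norm_sq_eq_of_L2] at h2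
    simpa [matOpCLM_apply] using h2
  · intro H h
    refine le_of_sq_le_sq ?_ (by positivity)
    rw [mul_pow, PiLp.norm_sq_eq_of_L2, PiLp.norm_sq_eq_of_L2]
    simpa [matOpCLM_apply] using H (WithLp.ofLp h)

lemma matBound_opMatNorm (M : Matrix ι ι (E →L[ℂ] E)) : MatBound M (opMatNorm M) :=
  (opMatNorm_le_iff M (opMatNorm_nonneg M)).1 le_rfl

namespace MatBound

lemma mono {M : ι → κ → E →L[ℂ] F} {c d : ℝ} (hM : MatBound M c) (hc : 0 ≤ c) (hcd : c ≤ d) :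
    MatBound M d := fun h => (hM h).trans (by gcongr)

lemma smul {M : ι → κ → E →L[ℂ] F} {c : ℝ} (hM : MatBound M c) (z : ℂ) :
    MatBound (fun i j => z • M i j) (‖z‖ * c) := by
  intro h
  have := hM h
  simp only [smul_apply, ← Finset.smul_sum, norm_smul, mul_pow,
    ← Finset.mul_sum]
  rw [mul_assoc]
  gcongr

lemma mul {M : ι → κ → F →L[ℂ] G} {N : κ → τ → E →L[ℂ] F} {c d : ℝ}
    (hM : MatBound M c) (hN : MatBound N d) :
    MatBound (fun i j => ∑ k, (M i k) ∘L (N k j)) (c * d) := by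
  intro h
  have h1 := hM fun k => ∑ j, N k j (h j)
  have h2 := hN h
  calc _ = ∑ i, ‖∑ k, M i k (∑ j, N k j (h j))‖ ^ 2 := by
        refine Finset.sum_congr rfl fun i _ => ?_
        simp only [sum_apply, ContinuousLinearMap.comp_apply, map_sum]
        rw [Finset.sum_comm]
    _ ≤ c ^ 2 * ∑ k, ‖∑ j, N k j (h j)‖ ^ 2 := h1
    _ ≤ c ^ 2 * (d ^ 2 * ∑ j, ‖h j‖ ^ 2) := by gcongr
    _ = _ := by ring

lemma reindex {ι' κ' : Type*} [Fintype ι'] [Fintype κ'] {M : ι → κ → E →L[ℂ] F} {c : ℝ}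
    (hM : MatBound M c) (e : ι' ≃ ι) (f : κ' ≃ κ) : MatBound (fun i j => M (e i) (f j)) c := by
  intro h
  have := hM (h ∘ f.symm)
  rw [← e.sum_comp, ← f.sum_comp (fun j => ‖(h ∘ f.symm) j‖ ^ 2)] at this
  simp_rw [← f.sum_comp (fun j => M _ j _)] at this
  simpa using this

lemma zero : MatBound (fun (_ : ι) (_ : κ) => (0 : E →L[ℂ] F)) 0 := by
  intro h
  simp

lemma of_blockDiagonal {ι' κ' : Type*} [Fintype ι'] [Fintype κ']
    {M : ι ⊕ ι' → κ ⊕ κ' → E →L[ℂ] F} {c : ℝ}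
    (h₁ : MatBound (fun i j => M (Sum.inl i) (Sum.inl j)) c)
    (h₂ : MatBound (fun i j => M (Sum.inr i) (Sum.inr j)) c)
    (h₁₂ : ∀ i j, M (Sum.inl i) (Sum.inr j) = 0) (h₂₁ : ∀ i j, M (Sum.inr i) (Sum.inl j) = 0) :
    MatBound M c := by
  intro h
  have e1 := h₁ (h ∘ Sum.inl)
  have e2 := h₂ (h ∘ Sum.inr)
  simp only [Function.comp_apply] at e1 e2
  simp only [Fintype.sum_sum_type, h₁₂, h₂₁, zero_apply, Finset.sum_const_zero, add_zero,
    zero_add]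
  linarith

lemma norm_entry_le {M : ι → κ → E →L[ℂ] F} {c : ℝ} (hM : MatBound M c) (hc : 0 ≤ c)
    (i : ι) (j : κ) : ‖M i j‖ ≤ c := by
  classical
  refine ContinuousLinearMap.opNorm_le_bound _ hc fun h => ?_
  have := hM (Pi.single j h)
  refine le_of_sq_le_sq ?_ (by positivity)
  have e1 : ∀ i, ∑ k, M i k ((Pi.single j h : κ → E) k) = M i j h := fun i => by
    rw [Finset.sum_eq_single j] <;> simp +contextual
  have e2 : ∑ k, ‖(Pi.single j h : κ → E) k‖ ^ 2 = ‖h‖ ^ 2 := by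
    rw [Finset.sum_eq_single j] <;> simp +contextual
  simp only [e1, e2] at this
  rw [mul_pow]
  exact (Finset.single_le_sum (f := fun i => ‖M i j h‖ ^ 2) (fun _ _ => by positivity)
    (Finset.mem_univ i)).trans this

lemma adjoint [CompleteSpace E] [CompleteSpace F] {M : ι → κ → E →L[ℂ] F} {c : ℝ}
    (hM : MatBound M c) :
    MatBound (fun j i => ContinuousLinearMap.adjoint (M i j)) c := by
  intro g
  set k : κ → E := fun j => ∑ i, ContinuousLinearMap.adjoint (M i j) (g i) with hk
  have h1 := hM k
  set S := ∑ j, ‖k j‖ ^ 2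
  set Q := ∑ i, ‖g i‖ ^ 2
  have key : S = ∑ i, RCLike.re (inner ℂ (g i) (∑ j, M i j (k j))) := by
    have hz : ∀ j z, inner ℂ (k j) z = ∑ i, inner ℂ (g i) (M i j z) := fun j z => by
      simp only [hk, sum_inner, ContinuousLinearMap.adjoint_inner_left]
    have : ∀ j, ‖k j‖ ^ 2 = ∑ i, RCLike.re (inner ℂ (g i) (M i j (k j))) := fun j => by
      rw [← inner_self_eq_norm_sq (𝕜 := ℂ), hz, map_sum]
    simp only [S, this, inner_sum, map_sum]
    rw [Finset.sum_comm]
  have h2 : S ^ 2 ≤ Q * (c ^ 2 * S) := by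
    calc S ^ 2 ≤ (∑ i, ‖g i‖ * ‖∑ j, M i j (k j)‖) ^ 2 := by
          refine pow_le_pow_left₀ (Finset.sum_nonneg fun _ _ => by positivity) ?_ 2
          rw [key]
          exact Finset.sum_le_sum fun i _ => re_inner_le_norm _ _
      _ ≤ Q * ∑ i, ‖∑ j, M i j (k j)‖ ^ 2 := Finset.sum_mul_sq_le_sq_mul_sq _ _ _
      _ ≤ _ := by gcongr
  have hS : 0 ≤ S := Finset.sum_nonneg fun _ _ => by positivity
  have hQ : 0 ≤ Q := Finset.sum_nonneg fun _ _ => by positivity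
  rcases hS.eq_or_lt with h0 | h0
  · rw [← h0]; positivity
  · refine le_of_mul_le_mul_right ?_ h0
    calc S * S = S ^ 2 := by ring
      _ ≤ _ := h2
      _ = _ := by ring

end MatBound

end MatBound

section Unitary

variable {κ : Type*} [Fintype κ] [DecidableEq κ]

lemma exists_isometry_of_dual_norm_eq {V : Type*} [AddCommGroup V] [Module ℂ V] (u w : κ → V)
    (h : ∀ f : Module.Dual ℂ V, ∑ k, ‖f (u k)‖ ^ 2 = ∑ k, ‖f (w k)‖ ^ 2) :
    ∃ W : Matrix κ κ ℂ, W.conjTranspose * W = 1 ∧ ∀ k, u k = ∑ l, W k l • w l := by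
  let ev : (κ → V) → Module.Dual ℂ V →ₗ[ℂ] EuclideanSpace ℂ κ := fun v =>
    (WithLp.linearEquiv 2 ℂ (κ → ℂ)).symm.toLinearMap ∘ₗ
      LinearMap.pi fun k => Module.Dual.eval ℂ V (v k)
  have ev_apply : ∀ v f k, ev v f k = f (v k) := fun v f k => rfl
  have hnorm : ∀ f, ‖ev u f‖ = ‖ev w f‖ := fun f => by
    rw [← sq_eq_sq₀ (norm_nonneg _) (norm_nonneg _), PiLp.norm_sq_eq_of_L2,
      PiLp.norm_sq_eq_of_L2]
    exact h f
  have hker : LinearMap.ker (ev w).rangeRestrict ≤ LinearMap.ker (ev u) := fun f hf => by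
    have h0 : ev w f = 0 := congrArg Subtype.val (LinearMap.mem_ker.1 hf)
    rw [LinearMap.mem_ker, ← norm_eq_zero, hnorm f, h0, norm_zero]
  obtain ⟨g, hg⟩ := ((ev w).rangeRestrict).exists_rightInverse_of_surjective
    (LinearMap.range_rangeRestrict _)
  have hgw : ∀ p, ev w (g p) = p := fun p =>
    congrArg Subtype.val (LinearMap.congr_fun hg p)
  let L : LinearMap.range (ev w) →ₗᵢ[ℂ] EuclideanSpace ℂ κ :=
    { toLinearMap := ev u ∘ₗ g
      norm_map' := fun p => by
        change ‖ev u (g p)‖ = ‖p‖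
        rw [hnorm, hgw]
        rfl }
  let T := L.extend
  have hT : ∀ f, T (ev w f) = ev u f := fun f => by
    have h1 : T (ev w f) = L ⟨ev w f, f, rfl⟩ := L.extend_apply ⟨ev w f, f, rfl⟩
    rw [h1]
    change ev u (g ⟨ev w f, f, rfl⟩) = ev u f
    rw [← sub_eq_zero, ← map_sub, ← norm_eq_zero, hnorm, map_sub, hgw, sub_self, norm_zero]
  let W : Matrix κ κ ℂ := Matrix.of fun k l => T (EuclideanSpace.single l 1) k
  have hTW : ∀ z k, T z k = ∑ l, W k l * z l := fun z k => by
    have hz : z = ∑ l, z l • EuclideanSpace.single l (1 : ℂ) := by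
      ext k
      simp [Finset.sum_apply, Pi.single_apply]
    conv_lhs => rw [hz]
    simp [W, mul_comm]
  refine ⟨W, ?_, fun k => ?_⟩
  · refine Matrix.ext fun l m => ?_
    have := T.inner_map_map (EuclideanSpace.single l 1) (EuclideanSpace.single m 1)
    rw [PiLp.inner_apply] at this
    simp only [RCLike.inner_apply] at this
    have h1 : (W.conjTranspose * W) l m = ∑ k, T (EuclideanSpace.single m 1) k *
        conj (T (EuclideanSpace.single l 1) k) := by
      rw [Matrix.mul_apply]
      exact Finset.sum_congr rfl fun k _ => mul_comm _ _
    rw [h1, this, Matrix.one_apply, EuclideanSpace.inner_single_left]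
    simp
  · rw [← sub_eq_zero, ← Module.forall_dual_apply_eq_zero_iff ℂ]
    intro f
    have := hTW (ev w f) k
    rw [hT] at this
    simp only [ev_apply] at this
    simp [this]

lemma sum_norm_sq_isometry {H : Type*} [NormedAddCommGroup H] [InnerProductSpace ℂ H]
    {W : Matrix κ κ ℂ} (hW : W.conjTranspose * W = 1) (g : κ → H) :
    ∑ k, ‖∑ l, W k l • g l‖ ^ 2 = ∑ k, ‖g k‖ ^ 2 := by
  have key : ∑ k, inner ℂ (∑ l, W k l • g l) (∑ l, W k l • g l) =
      ∑ k, inner ℂ (g k) (g k) := by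
    calc _ = ∑ l, ∑ m, (W.conjTranspose * W) m l * inner ℂ (g m) (g l) := by
          simp only [sum_inner, inner_sum, inner_smul_left, inner_smul_right, Matrix.mul_apply,
            Matrix.conjTranspose_apply, RCLike.star_def, Finset.sum_mul, Finset.mul_sum]
          rw [Finset.sum_comm]
          refine Finset.sum_congr rfl fun l _ => ?_
          rw [Finset.sum_comm]
          exact Finset.sum_congr rfl fun m _ => Finset.sum_congr rfl fun k _ => by ring
      _ = _ := by simp [hW, Matrix.one_apply]
  have := congrArg Complex.re key
  simpa only [Complex.re_sum, inner_self_eq_norm_sq_to_K, ← Complex.ofReal_pow,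
    Complex.coe_algebraMap, Complex.ofReal_re] using this

end Unitary

section Neumann

variable {H : Type*} [NormedAddCommGroup H] [InnerProductSpace ℂ H] [CompleteSpace H]
  {ι : Type*} [Fintype ι] [DecidableEq ι]

attribute [local instance] Matrix.linftyOpNormedRing

lemma isUnit_one_sub_of_matBound (R : Subalgebra ℂ (H →L[ℂ] H))
    (hR : IsClosed (R : Set (H →L[ℂ] H))) (M : Matrix ι ι R) {ρ : ℝ} (h0 : 0 ≤ ρ) (h1 : ρ < 1)
    (hM : MatBound (fun i j => (M i j : H →L[ℂ] H)) ρ) : IsUnit (1 - M) := by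
  have hpow : ∀ n, MatBound (fun i j => ((M ^ (n + 1)) i j : H →L[ℂ] H)) (ρ ^ (n + 1)) := by
    intro n
    induction n with
    | zero => simpa using hM
    | succ n ih =>
      rw [pow_succ, pow_succ ρ]
      have := ih.mul hM
      convert this using 3 with i j
      rw [Matrix.mul_apply, AddSubmonoidClass.coe_finsetSum]
      rfl
  have : CompleteSpace R := hR.completeSpace_coe
  have htend : Filter.Tendsto (fun n : ℕ => (Fintype.card ι : ℝ) * ρ ^ (n + 1)) Filter.atTop
      (nhds 0) := by
    simpa using ((tendsto_pow_atTop_nhds_zero_of_lt_one h0 h1).comp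
      (Filter.tendsto_add_atTop_nat 1)).const_mul (Fintype.card ι : ℝ)
  obtain ⟨n, hn⟩ := (htend.eventually (gt_mem_nhds one_pos)).exists
  have hlt : ‖M ^ (n + 1)‖ < 1 := by
    refine lt_of_le_of_lt ?_ hn
    rw [Matrix.linfty_opNorm_def]
    have : ∀ i j, ‖(M ^ (n + 1)) i j‖ ≤ ρ ^ (n + 1) := fun i j =>
      (hpow n).norm_entry_le (by positivity) i j
    have hsup : (Finset.univ.sup fun i => ∑ j, ‖(M ^ (n + 1)) i j‖₊) ≤
        (⟨Fintype.card ι * ρ ^ (n + 1), by positivity⟩ : NNReal) := by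
      refine Finset.sup_le fun i _ => ?_
      refine NNReal.coe_le_coe.1 ?_
      rw [NNReal.coe_sum]
      calc _ ≤ ∑ _j : ι, ρ ^ (n + 1) := Finset.sum_le_sum fun j _ => this i j
        _ = Fintype.card ι * ρ ^ (n + 1) := by simp
    exact NNReal.coe_le_coe.2 hsup
  have : @CompleteSpace (Matrix ι ι R) PseudoMetricSpace.toUniformSpace :=
    inferInstanceAs (CompleteSpace (ι → ι → R))
  have hu : IsUnit (1 - M ^ (n + 1)) := isUnit_one_sub_of_norm_lt_one hlt
  rw [← mul_neg_geom_sum] at hu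
  refine (Commute.isUnit_mul_iff ?_).1 hu |>.1
  exact Commute.sum_right _ _ _ fun i _ =>
    (Commute.one_left _).sub_left ((Commute.refl M).pow_right i)

end Neumann

section Transfer

open scoped Matrix.Module

variable {H : Type*} [NormedAddCommGroup H] [InnerProductSpace ℂ H] [CompleteSpace H]
  {ι : Type*} [Fintype ι] [DecidableEq ι]

lemma map_algebraMap_smul_apply {R : Type*} [Ring R] [Algebra ℂ R] {M : Type*}
    [AddCommGroup M] [Module ℂ M]
    [Module R M] [IsScalarTower ℂ R M] (W : Matrix ι ι ℂ) (g : ι → M) (i : ι) :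
    (W.map (algebraMap ℂ R) • g) i = ∑ j, W i j • g j := by
  simp [Matrix.Module.smul_apply]

lemma sum_smul_sumElim {R : Type*} [Ring R] [Algebra ℂ R] {M : Type*} [AddCommGroup M]
    [Module ℂ M] [Module R M] [IsScalarTower ℂ R M] (W : Matrix (ι ⊕ ι) (ι ⊕ ι) ℂ) (w z : ι → M)
    (k : ι ⊕ ι) : ∑ l, W k l • Sum.elim w z l =
      Sum.elim (W.toBlocks₁₁.map (algebraMap ℂ R) • w + W.toBlocks₁₂.map (algebraMap ℂ R) • z)
        (W.toBlocks₂₁.map (algebraMap ℂ R) • w + W.toBlocks₂₂.map (algebraMap ℂ R) • z) k := by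
  rcases k with k | k <;>
    simp only [Sum.elim_inl, Sum.elim_inr, Pi.add_apply, map_algebraMap_smul_apply,
      Fintype.sum_sum_type] <;> rfl

/-- If a unitary matrix of scalars maps the tuple `(w, a v)` to `(u, v)` and `a` is a strict
contraction, then `u` is the image of `w` under a contraction. -/
lemma exists_transfer_contraction (R : Subalgebra ℂ (H →L[ℂ] H))
    (hR : IsClosed (R : Set (H →L[ℂ] H))) {V : Type*} [AddCommGroup V] [Module ℂ V] [Module R V]
    [IsScalarTower ℂ R V] {W : Matrix (ι ⊕ ι) (ι ⊕ ι) ℂ} (hW : W.conjTranspose * W = 1)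
    (a : Matrix ι ι R) {ρ : ℝ} (h0 : 0 ≤ ρ) (h1 : ρ < 1)
    (ha : MatBound (fun i j => (a i j : H →L[ℂ] H)) ρ) (u v w : ι → V)
    (huv : ∀ k, Sum.elim u v k = ∑ l, W k l • Sum.elim w (a • v) l) :
    ∃ T : Matrix ι ι R, MatBound (fun i j => (T i j : H →L[ℂ] H)) 1 ∧ u = T • w := by
  let S : Matrix ι ι ℂ → Matrix ι ι R := fun Z => Z.map (algebraMap ℂ R)
  have : IsScalarTower ℂ R H := ⟨fun _ _ _ => rfl⟩
  have hSW : MatBound (fun i j => (S W.toBlocks₂₂ i j : H →L[ℂ] H)) 1 := by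
    intro g
    have := sum_norm_sq_isometry hW (Sum.elim 0 g)
    simp only [Fintype.sum_sum_type, Sum.elim_inl, Sum.elim_inr] at this
    simp only [Pi.zero_apply, smul_zero, Finset.sum_const_zero, zero_add, norm_zero,
      ne_eq, OfNat.ofNat_ne_zero, not_false_eq_true, zero_pow] at this
    rw [one_pow, one_mul, ← this]
    refine le_add_of_nonneg_of_le (Finset.sum_nonneg fun _ _ => by positivity) (le_of_eq ?_)
    rfl
  have hb : MatBound (fun i j => ((S W.toBlocks₂₂ * a) i j : H →L[ℂ] H)) ρ := by
    have := hSW.mul ha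
    rw [one_mul] at this
    convert this using 3 with i j
    rw [Matrix.mul_apply, AddSubmonoidClass.coe_finsetSum]
    rfl
  obtain ⟨B, hB⟩ := isUnit_one_sub_of_matBound R hR (S W.toBlocks₂₂ * a) h0 h1 hb
  let Q : Matrix ι ι R := (↑B⁻¹ : Matrix ι ι R) * S W.toBlocks₂₁
  have hQ : (1 - S W.toBlocks₂₂ * a) * Q = S W.toBlocks₂₁ := by
    rw [← hB, ← mul_assoc, B.mul_inv, one_mul]
  let T : Matrix ι ι R := S W.toBlocks₁₁ + S W.toBlocks₁₂ * (a * Q)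
  have hTQ : ∀ g : ι → H, ∀ k, Sum.elim (T • g) (Q • g) k =
      ∑ l, W k l • Sum.elim g (a • Q • g) l := by
    intro g k
    rw [sum_smul_sumElim (R := R)]
    congr 1
    · simp only [S, T, add_smul, mul_smul]
    · have := congrArg (· • g) hQ
      simp only [sub_mul, one_mul, sub_smul, mul_smul] at this
      rw [← this, sub_add_cancel]
  refine ⟨T, fun g => ?_, ?_⟩
  · have e1 := sum_norm_sq_isometry hW (Sum.elim g (a • Q • g))
    simp only [← hTQ, Fintype.sum_sum_type, Sum.elim_inl, Sum.elim_inr] at e1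
    have e2 : ∑ i, ‖(a • Q • g) i‖ ^ 2 ≤ 1 ^ 2 * ∑ i, ‖(Q • g) i‖ ^ 2 :=
      ha.mono h0 h1.le (Q • g)
    have e3 : ∑ i, ‖(T • g) i‖ ^ 2 ≤ 1 ^ 2 * ∑ i, ‖g i‖ ^ 2 := by linarith
    exact e3
  · have hu : u = S W.toBlocks₁₁ • w + S W.toBlocks₁₂ • a • v := by
      ext i; have := huv (Sum.inl i); rwa [sum_smul_sumElim (R := R)] at this
    have hv : v = S W.toBlocks₂₁ • w + S W.toBlocks₂₂ • a • v := by
      ext i; have := huv (Sum.inr i); rwa [sum_smul_sumElim (R := R)] at this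
    have hv' : v = Q • w := by
      have h2 : (B : Matrix ι ι R) • v = S W.toBlocks₂₁ • w := by
        rw [hB, sub_smul, one_smul, mul_smul, sub_eq_iff_eq_add]
        exact hv
      simp only [Q, mul_smul, ← h2]
      rw [← mul_smul, B.inv_mul, one_smul]
    rw [hu]
    simp only [T, add_smul, mul_smul, ← hv']

end Transfer

section PositiveForm

open scoped Matrix.Module

/-- The quadratic function `f ↦ |f v|²` on the dual space attached to a vector `v`. -/
noncomputable def dualNormSq {V : Type*} [AddCommGroup V] [Module ℂ V] (v : V)
    (f : Module.Dual ℂ V) : ℝ :=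
  ‖f v‖ ^ 2

/-- The real vector space spanned by the functions `f ↦ |f v|²`. -/
abbrev QuadSpan (V : Type*) [AddCommGroup V] [Module ℂ V] : Type _ :=
  Submodule.span ℝ (Set.range (dualNormSq (V := V)))

namespace QuadSpan

variable {V : Type*} [AddCommGroup V] [Module ℂ V]

/-- The function `f ↦ |f v|²` as an element of `QuadSpan V`. -/
noncomputable def sq (v : V) : QuadSpan V := ⟨dualNormSq v, Submodule.subset_span ⟨v, rfl⟩⟩

/-- Evaluation of an element of `QuadSpan V` at a functional. -/
noncomputable def eval (f : Module.Dual ℂ V) : QuadSpan V →ₗ[ℝ] ℝ :=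
  LinearMap.proj f ∘ₗ Submodule.subtype _

@[simp] lemma eval_sq (f : Module.Dual ℂ V) (v : V) : eval f (sq v) = ‖f v‖ ^ 2 := rfl

lemma ext_eval {S T : QuadSpan V} (h : ∀ f, eval f S = eval f T) : S = T :=
  Subtype.ext (funext h)

@[simp] lemma sq_zero : sq (0 : V) = 0 := ext_eval fun f => by simp

lemma sq_smul (c : ℂ) (v : V) : sq (c • v) = (‖c‖ ^ 2) • sq v :=
  ext_eval fun f => by simp [mul_pow]

lemma sq_add_add_sq_sub (u v : V) : sq (u + v) + sq (u - v) = (2 : ℝ) • sq u + (2 : ℝ) • sq v :=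
  ext_eval fun f => by
    have := parallelogram_law_with_norm ℝ (f u) (f v)
    simp only [map_add, map_sub, eval_sq, map_smul, smul_eq_mul]
    linarith

/-- The real part of the sesquilinear expression `conj (f u) * f v`. -/
noncomputable def re (u v : V) : QuadSpan V := (1 / 4 : ℝ) • (sq (u + v) - sq (u - v))

lemma eval_re (f : Module.Dual ℂ V) (u v : V) : eval f (re u v) = (conj (f u) * f v).re := by
  simp only [re, map_smul, map_sub, map_add, eval_sq, smul_eq_mul, Complex.sq_norm,
    Complex.normSq_apply, Complex.add_re, Complex.add_im, Complex.sub_re, Complex.sub_im,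
    Complex.mul_re, Complex.conj_re, Complex.conj_im]
  ring

lemma re_self (v : V) : re v v = sq v :=
  ext_eval fun f => by
    rw [eval_re, eval_sq, Complex.sq_norm, Complex.normSq_apply]
    simp

/-- A positive functional on `QuadSpan V` defines a positive sesquilinear form on `V`. -/
@[reducible] noncomputable def core (F : QuadSpan V →ₗ[ℝ] ℝ) (hF : ∀ v, 0 ≤ F (sq v)) :
    PreInnerProductSpace.Core ℂ V where
  inner u v := ⟨F (re u v), -F (re u (Complex.I • v))⟩
  conj_inner_symm u v := by
    have h1 : re v u = re u v := ext_eval fun f => by simp [eval_re]; ring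
    have h2 : re v (Complex.I • u) = -re u (Complex.I • v) := ext_eval fun f => by
      simp [eval_re]; ring
    apply Complex.ext <;> simp [h1, h2]
  re_inner_nonneg v := by
    change 0 ≤ F (re v v)
    rw [re_self]
    exact hF v
  add_left u v w := by
    have h : ∀ z, re (u + v) z = re u z + re v z := fun z => ext_eval fun f => by
      simp [eval_re]; ring
    apply Complex.ext <;> simp [h, add_comm]
  smul_left u v c := by
    have h1 : re (c • u) v = c.re • re u v + (-c.im) • re u (Complex.I • v) :=
      ext_eval fun f => by simp [eval_re]; ring
    have h2 : re (c • u) (Complex.I • v) = c.re • re u (Complex.I • v) + c.im • re u v :=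
      ext_eval fun f => by simp [eval_re]; ring
    apply Complex.ext <;> simp [h1, h2] <;> ring

lemma re_core_inner_self (F : QuadSpan V →ₗ[ℝ] ℝ) (hF : ∀ v, 0 ≤ F (sq v)) (v : V) :
    ((core F hF).inner v v).re = F (sq v) := by
  rw [← re_self]
  rfl

end QuadSpan

variable {H : Type} [NormedAddCommGroup H] [InnerProductSpace ℂ H]
  {X : Submodule ℂ (H →L[ℂ] H)}
  {V : Type} [AddCommGroup V] [Module ℂ V]

/-- Generators of the inequalities which a functional on `QuadSpan V` has to satisfy in order to
define a suitable semi-inner product. -/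
def IsAdmissible (R : Subalgebra ℂ (H →L[ℂ] H)) [Module R V] (mk : X →ₗ[ℂ] H →ₗ[ℂ] V)
    (Φ : X → V →ₗ[ℂ] H) (S : QuadSpan V) (r : ℝ) : Prop :=
  ∃ (ι : Type) (_ : Fintype ι) (y x : Matrix ι ι X) (h : ι → H) (u v : ι → V) (a : Matrix ι ι R)
    (ρ : ℝ), MatBound (fun i j => (y i j : H →L[ℂ] H)) 1 ∧
      MatBound (fun i j => (x i j : H →L[ℂ] H)) 1 ∧ 0 ≤ ρ ∧ ρ < 1 ∧
      MatBound (fun i j => (a i j : H →L[ℂ] H)) ρ ∧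
      S = ∑ i, (QuadSpan.sq (∑ j, mk (y i j) (h j)) + QuadSpan.sq (∑ j, a i j • v j) -
        QuadSpan.sq (u i) - QuadSpan.sq (v i)) ∧
      ∑ i, ‖h i‖ ^ 2 - ∑ i, ‖∑ k, Φ (x k i) (u k)‖ ^ 2 ≤ r

namespace IsAdmissible

open QuadSpan

variable {R : Subalgebra ℂ (H →L[ℂ] H)} [Module R V] {mk : X →ₗ[ℂ] H →ₗ[ℂ] V} {Φ : X → V →ₗ[ℂ] H}

lemma zero : IsAdmissible R mk Φ 0 0 :=
  ⟨Empty, inferInstance, 0, 0, 0, 0, 0, 0, 0,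
    fun _ => by simp, fun _ => by simp, le_rfl, one_pos, fun _ => by simp, by simp, by simp⟩

lemma add {S T : QuadSpan V} {r s : ℝ} (h₁ : IsAdmissible R mk Φ S r)
    (h₂ : IsAdmissible R mk Φ T s) (hΦ : Φ 0 = 0) : IsAdmissible R mk Φ (S + T) (r + s) := by
  obtain ⟨ι, _, y, x, h, u, v, a, ρ, hy, hx, h0, h1, ha, rfl, hr⟩ := h₁
  obtain ⟨ι', _, y', x', h', u', v', a', ρ', hy', hx', h0', h1', ha', rfl, hr'⟩ := h₂
  refine ⟨ι ⊕ ι', inferInstance, Matrix.fromBlocks y 0 0 y', Matrix.fromBlocks x 0 0 x',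
    Sum.elim h h', Sum.elim u u', Sum.elim v v', Matrix.fromBlocks a 0 0 a', max ρ ρ',
    .of_blockDiagonal hy hy' (fun _ _ => rfl) (fun _ _ => rfl),
    .of_blockDiagonal hx hx' (fun _ _ => rfl) (fun _ _ => rfl),
    le_max_of_le_left h0, max_lt h1 h1',
    .of_blockDiagonal (ha.mono h0 (le_max_left _ _)) (ha'.mono h0' (le_max_right _ _))
      (fun _ _ => rfl) (fun _ _ => rfl), ?_, ?_⟩
  · simp only [Fintype.sum_sum_type, Matrix.fromBlocks_apply₁₁, Matrix.fromBlocks_apply₁₂,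
      Matrix.fromBlocks_apply₂₁, Matrix.fromBlocks_apply₂₂, Sum.elim_inl, Sum.elim_inr,
      Matrix.zero_apply, map_zero, LinearMap.zero_apply, zero_smul, Finset.sum_const_zero,
      add_zero, zero_add]
  · simp [hΦ]
    linarith

lemma smul [IsScalarTower ℂ R V] {S : QuadSpan V} {r : ℝ} (h : IsAdmissible R mk Φ S r)
    {c : ℝ} (hc : 0 ≤ c) :
    IsAdmissible R mk Φ (c • S) (c * r) := by
  obtain ⟨ι, _, y, x, h, u, v, a, ρ, hy, hx, h0, h1, ha, rfl, hr⟩ := h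
  set z : ℂ := (Real.sqrt c : ℂ) with hz
  have hzc : ‖z‖ ^ 2 = c := by simp [hz, Real.sq_sqrt hc]
  have hcomm : ∀ (b : R) (w : V), b • z • w = z • b • w := fun b w => by
    rw [← algebraMap_smul R z w, ← algebraMap_smul R z (b • w), ← mul_smul, ← mul_smul,
      Algebra.commutes]
  refine ⟨ι, inferInstance, y, x, z • h, z • u, z • v, a, ρ, hy, hx, h0, h1, ha, ?_, ?_⟩
  · simp only [Pi.smul_apply, map_smul, hcomm, ← Finset.smul_sum, sq_smul, hzc, ← smul_add,
      ← smul_sub]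
  · simp only [Pi.smul_apply, map_smul, ← Finset.smul_sum, norm_smul, mul_pow, hzc,
      ← Finset.mul_sum, ← mul_sub]
    gcongr

lemma neg_sq (v : V) : IsAdmissible R mk Φ (-sq v) 0 := by
  refine ⟨Unit, inferInstance, fun _ _ => 0, fun _ _ => 0, 0, fun _ => v, 0, 0, 0,
    fun _ => by simp, fun _ => by simp, le_rfl, one_pos, fun _ => by simp, by simp, ?_⟩
  simp

lemma mono {S : QuadSpan V} {r s : ℝ} (h : IsAdmissible R mk Φ S r) (hrs : r ≤ s) :
    IsAdmissible R mk Φ S s := by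
  obtain ⟨ι, _, y, x, h, u, v, a, ρ, hy, hx, h0, h1, ha, hS, hr⟩ := h
  exact ⟨ι, _, y, x, h, u, v, a, ρ, hy, hx, h0, h1, ha, hS, hr.trans hrs⟩

lemma exists_sq_mk (y : X) (h : H) : ∃ r, IsAdmissible R mk Φ (sq (mk y h)) r := by
  have hpos : (0 : ℝ) < ‖y‖ + 1 := by positivity
  set z : ℂ := ((‖y‖ + 1 : ℝ) : ℂ) with hz
  have hz0 : z ≠ 0 := by simpa [hz] using Complex.ofReal_ne_zero.2 hpos.ne'
  refine ⟨_, Unit, inferInstance, fun _ _ => z⁻¹ • y, fun _ _ => 0, fun _ => z • h, 0, 0, 0, 0,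
    fun g => ?_, fun _ => by simp, le_rfl, one_pos, fun _ => by simp, ?_, le_rfl⟩
  · have hle : ‖(y : H →L[ℂ] H) (g ())‖ ≤ (‖y‖ + 1) * ‖g ()‖ :=
      ((y : H →L[ℂ] H).le_opNorm _).trans (by gcongr; exact le_add_of_nonneg_right zero_le_one)
    have hle2 : ‖z⁻¹ • (y : H →L[ℂ] H) (g ())‖ ≤ ‖g ()‖ := by
      rw [norm_smul, norm_inv, hz, Complex.norm_real, Real.norm_of_nonneg hpos.le,
        inv_mul_le_iff₀ hpos]
      exact hle
    simpa using pow_le_pow_left₀ (norm_nonneg _) hle2 2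
  · simp [smul_smul, hz0]

lemma exists_of_span [IsScalarTower ℂ R V] (hΦ : Φ 0 = 0)
    (hspan : Submodule.span ℂ {w : V | ∃ y h, w = mk y h} = ⊤) (S : QuadSpan V) :
    ∃ r, IsAdmissible R mk Φ S r := by
  have hsq : ∀ v : V, ∃ r, IsAdmissible R mk Φ (sq v) r := by
    intro v
    have hv : v ∈ Submodule.span ℂ {w : V | ∃ y h, w = mk y h} := by rw [hspan]; trivial
    induction hv using Submodule.span_induction with
    | mem w hw =>
      obtain ⟨y, h, rfl⟩ := hw
      exact exists_sq_mk y h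
    | zero => exact ⟨0, by simpa using zero⟩
    | add u v _ _ hu hv =>
      obtain ⟨r, hr⟩ := hu
      obtain ⟨s, hs⟩ := hv
      have := ((hr.smul zero_le_two).add (hs.smul zero_le_two) hΦ).add (neg_sq (u - v)) hΦ
      rw [← sq_add_add_sq_sub, add_neg_cancel_right] at this
      exact ⟨_, this⟩
    | smul c u _ hu =>
      obtain ⟨r, hr⟩ := hu
      exact ⟨_, by rw [sq_smul]; exact hr.smul (by positivity)⟩
  suffices h : ∀ (T : Module.Dual ℂ V → ℝ) (hT : T ∈ Submodule.span ℝ (Set.range (dualNormSq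
      (V := V)))), (∃ r, IsAdmissible R mk Φ ⟨T, hT⟩ r) ∧ ∃ r, IsAdmissible R mk Φ (-⟨T, hT⟩) r from
    (h S.1 S.2).1
  intro T hT
  induction hT using Submodule.span_induction with
  | mem T hT =>
    obtain ⟨v, rfl⟩ := hT
    exact ⟨hsq v, 0, neg_sq v⟩
  | zero => exact ⟨⟨0, zero⟩, 0, by convert zero (R := R) (mk := mk) (Φ := Φ); exact neg_zero⟩
  | add S T hS hT h₁ h₂ =>
    obtain ⟨⟨r, hr⟩, r', hr'⟩ := h₁
    obtain ⟨⟨s, hs⟩, s', hs'⟩ := h₂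
    refine ⟨⟨_, hr.add hs hΦ⟩, r' + s', ?_⟩
    · have := hr'.add hs' hΦ
      rw [← neg_add] at this
      exact this
  | smul c S hS h =>
    obtain ⟨⟨r, hr⟩, r', hr'⟩ := h
    rcases le_total 0 c with hc | hc
    · refine ⟨⟨_, hr.smul hc⟩, c * r', ?_⟩
      · have := hr'.smul hc
        rw [smul_neg] at this
        exact this
    · have hc' : 0 ≤ -c := neg_nonneg.2 hc
      have e : (-c) • (⟨S, hS⟩ : QuadSpan V) = -⟨c • S, Submodule.smul_mem _ c hS⟩ :=
        Subtype.ext (neg_smul c S)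
      refine ⟨⟨-c * r', ?_⟩, -c * r, ?_⟩
      · have := hr'.smul hc'
        rw [smul_neg, e, neg_neg] at this
        exact this
      · have := hr.smul hc'
        rw [e] at this
        exact this

lemma nonneg [CompleteSpace H] [IsScalarTower ℂ R V] (hR : IsClosed (R : Set (H →L[ℂ] H)))
    (hRX : ∀ T ∈ R, ∀ x ∈ X, T * x ∈ X)
    (hmk : ∀ (T : R) (y : X) h, mk ⟨T * y, hRX T T.2 y y.2⟩ h = T • mk y h)
    (hCS : ∀ (ι : Type) [Fintype ι] (y x : Matrix ι ι X),
      MatBound (fun i j => (y i j : H →L[ℂ] H)) 1 → MatBound (fun i j => (x i j : H →L[ℂ] H)) 1 →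
      ∀ h : ι → H, ∑ i, ‖∑ k, Φ (x k i) (∑ j, mk (y k j) (h j))‖ ^ 2 ≤ ∑ j, ‖h j‖ ^ 2)
    {r : ℝ} (H0 : IsAdmissible R mk Φ 0 r) : 0 ≤ r := by
  classical
  obtain ⟨ι, _, y, x, h, u, v, a, ρ, hy, hx, h0, h1, ha, hS, hr⟩ := H0
  set w : ι → V := fun i => ∑ j, mk (y i j) (h j) with hw
  have hf : ∀ f : Module.Dual ℂ V, ∑ k, ‖f (Sum.elim u v k)‖ ^ 2 =
      ∑ k, ‖f (Sum.elim w (a • v) k)‖ ^ 2 := by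
    intro f
    have := congrArg (eval f) hS
    simp only [map_zero, map_sum, map_add, map_sub, Finset.sum_add_distrib,
      Finset.sum_sub_distrib, eval_sq] at this
    simp only [Fintype.sum_sum_type, Sum.elim_inl, Sum.elim_inr, hw, Matrix.Module.smul_apply,
      map_sum]
    linarith
  obtain ⟨W, hW, hWuv⟩ := exists_isometry_of_dual_norm_eq _ _ hf
  obtain ⟨T, hT, hTu⟩ := exists_transfer_contraction R hR hW a h0 h1 ha u v w hWuv
  let y' : Matrix ι ι X := fun i j => ∑ k, ⟨T i k * y k j, hRX _ (T i k).2 _ (y k j).2⟩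
  have hy' : MatBound (fun i j => (y' i j : H →L[ℂ] H)) 1 := by
    have := hT.mul hy
    rw [one_mul] at this
    convert this using 3 with i j
    simp only [y', AddSubmonoidClass.coe_finsetSum]
    rfl
  have hu : ∀ k, u k = ∑ j, mk (y' k j) (h j) := by
    intro k
    rw [hTu]
    simp only [Matrix.Module.smul_apply, hw, y', map_sum, LinearMap.sum_apply, hmk,
      Finset.smul_sum]
    exact Finset.sum_comm
  have := hCS ι y' x hy' hx h
  simp only [← hu] at this
  linarith

lemma exists_functional [IsScalarTower ℂ R V] (hΦ : Φ 0 = 0)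
    (hspan : Submodule.span ℂ {w : V | ∃ y h, w = mk y h} = ⊤)
    (hnonneg : ∀ r, IsAdmissible R mk Φ 0 r → 0 ≤ r) :
    ∃ F : QuadSpan V →ₗ[ℝ] ℝ, ∀ S r, IsAdmissible R mk Φ S r → F S ≤ r := by
  let s : PointedCone ℝ (QuadSpan V × ℝ) :=
    { carrier := {p | IsAdmissible R mk Φ p.1 p.2}
      add_mem' := fun hp hq => hp.add hq hΦ
      zero_mem' := zero
      smul_mem' := fun c _ hp => hp.smul c.2 }
  let f : (QuadSpan V × ℝ) →ₗ.[ℝ] ℝ :=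
    ⟨LinearMap.range (LinearMap.inr ℝ (QuadSpan V) ℝ),
      LinearMap.snd ℝ (QuadSpan V) ℝ ∘ₗ Submodule.subtype _⟩
  have hf : ∀ x : f.domain, (x : QuadSpan V × ℝ) ∈ s → 0 ≤ f x := by
    rintro ⟨_, t, rfl⟩ h
    exact hnonneg t h
  have hdense : ∀ p, ∃ x : f.domain, (x : QuadSpan V × ℝ) + p ∈ s := by
    rintro ⟨S, t⟩
    obtain ⟨r, hr⟩ := exists_of_span (R := R) hΦ hspan S
    refine ⟨⟨(0, r - t), r - t, rfl⟩, ?_⟩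
    change IsAdmissible R mk Φ (0 + S) (r - t + t)
    simpa using hr
  obtain ⟨g, hgf, hg⟩ := riesz_extension s f hf hdense
  refine ⟨-(g ∘ₗ LinearMap.inl ℝ (QuadSpan V) ℝ), fun S r h => ?_⟩
  have h1 : g (S, r) = g (S, 0) + g (0, r) := by rw [← map_add]; simp
  have h2 : g (0, r) = r := hgf ⟨(0, r), r, rfl⟩
  have h3 := hg (S, r) h
  simp only [LinearMap.neg_apply, LinearMap.comp_apply, LinearMap.inl_apply]
  linarith

end IsAdmissible

/-- Existence of a semi-inner product on `V` for which the row `mk` and the column `Φ` are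
completely contractive and on which `R` acts completely contractively. -/
theorem exists_preInnerProductSpace_core [CompleteSpace H] (R : Subalgebra ℂ (H →L[ℂ] H))
    [Module R V] [IsScalarTower ℂ R V] (hR : IsClosed (R : Set (H →L[ℂ] H)))
    (mk : X →ₗ[ℂ] H →ₗ[ℂ] V) (Φ : X → V →ₗ[ℂ] H)
    (hRX : ∀ T ∈ R, ∀ x ∈ X, T * x ∈ X)
    (hmk : ∀ (T : R) (y : X) h, mk ⟨T * y, hRX T T.2 y y.2⟩ h = T • mk y h)
    (hCS : ∀ (ι : Type) [Fintype ι] (y x : Matrix ι ι X),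
      MatBound (fun i j => (y i j : H →L[ℂ] H)) 1 → MatBound (fun i j => (x i j : H →L[ℂ] H)) 1 →
      ∀ h : ι → H, ∑ i, ‖∑ k, Φ (x k i) (∑ j, mk (y k j) (h j))‖ ^ 2 ≤ ∑ j, ‖h j‖ ^ 2)
    (hΦ : Φ 0 = 0) (hspan : Submodule.span ℂ {w : V | ∃ y h, w = mk y h} = ⊤) :
    ∃ c : PreInnerProductSpace.Core ℂ V, ∀ (ι : Type) [Fintype ι],
      (∀ y : Matrix ι ι X, MatBound (fun i j => (y i j : H →L[ℂ] H)) 1 → ∀ h : ι → H,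
        ∑ i, (c.inner (∑ j, mk (y i j) (h j)) (∑ j, mk (y i j) (h j))).re ≤ ∑ j, ‖h j‖ ^ 2) ∧
      (∀ x : Matrix ι ι X, MatBound (fun i j => (x i j : H →L[ℂ] H)) 1 → ∀ u : ι → V,
        ∑ i, ‖∑ k, Φ (x k i) (u k)‖ ^ 2 ≤ ∑ k, (c.inner (u k) (u k)).re) ∧
      (∀ a : Matrix ι ι R, MatBound (fun i j => (a i j : H →L[ℂ] H)) 1 → ∀ v : ι → V,
        ∑ i, (c.inner (∑ j, a i j • v j) (∑ j, a i j • v j)).re ≤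
          ∑ j, (c.inner (v j) (v j)).re) := by
  obtain ⟨F, hF⟩ := IsAdmissible.exists_functional (R := R) (mk := mk) hΦ hspan fun r h =>
    h.nonneg hR hRX hmk hCS
  have hpos : ∀ v, 0 ≤ F (QuadSpan.sq v) := fun v => by
    have := hF _ _ (IsAdmissible.neg_sq v)
    rwa [map_neg, Left.neg_nonpos_iff] at this
  refine ⟨QuadSpan.core F hpos, fun ι _ => ?_⟩
  simp only [QuadSpan.re_core_inner_self]
  have h0 : MatBound (fun _ _ : ι => (0 : H →L[ℂ] H)) 1 := fun h => by
    simpa using Finset.sum_nonneg fun i _ => by positivity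
  have h0' : MatBound (fun _ _ : ι => (0 : H →L[ℂ] H)) 0 := fun h => by simp
  refine ⟨fun y hy h => ?_, fun x hx u => ?_, fun a ha v => ?_⟩
  · have := hF _ _ ⟨ι, _, y, 0, h, 0, 0, 0, 0, hy, h0, le_rfl, one_pos, h0', rfl, le_rfl⟩
    simpa [hΦ] using this
  · have := hF _ _ ⟨ι, _, 0, x, 0, u, 0, 0, 0, h0, hx, le_rfl, one_pos, h0', rfl, le_rfl⟩
    simpa [hΦ] using this
  · have key : ∀ ρ : ℝ, 0 ≤ ρ → ρ < 1 → ρ ^ 2 * ∑ i, F (QuadSpan.sq (∑ j, a i j • v j)) ≤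
        ∑ j, F (QuadSpan.sq (v j)) := by
      intro ρ hρ0 hρ1
      have hρa := ha.smul (ρ : ℂ)
      rw [Complex.norm_real, Real.norm_of_nonneg hρ0, mul_one] at hρa
      have := hF _ _ ⟨ι, _, 0, 0, 0, 0, v, (ρ : ℂ) • a, ρ, h0, h0, hρ0, hρ1, hρa, rfl, le_rfl⟩
      simp only [Matrix.smul_apply, smul_assoc, ← Finset.smul_sum, QuadSpan.sq_smul] at this
      simpa [hΦ, Finset.mul_sum] using this
    have hlim : Filter.Tendsto (fun ρ : ℝ => ρ ^ 2 * ∑ i, F (QuadSpan.sq (∑ j, a i j • v j)))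
        (nhdsWithin 1 (Set.Iio 1)) (nhds (1 ^ 2 * ∑ i, F (QuadSpan.sq (∑ j, a i j • v j)))) :=
      ((continuous_pow 2).mul continuous_const).continuousAt.tendsto.mono_left
        nhdsWithin_le_nhds
    rw [one_pow, one_mul] at hlim
    refine le_of_tendsto hlim ?_
    filter_upwards [Ioo_mem_nhdsLT (zero_lt_one' ℝ)] with ρ hρ using key ρ hρ.1.le hρ.2

end PositiveForm

section CyclicModule

variable {H : Type} [NormedAddCommGroup H] [InnerProductSpace ℂ H]
  {X : Submodule ℂ (H →L[ℂ] H)} {R : Subalgebra ℂ (H →L[ℂ] H)}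

/-- An `R`-module generated by symbols `y ⊗ h`, on which the operators `y ⊗ h ↦ ⟨x, y⟩ h` are
defined, and which is reduced with respect to these operators. -/
lemma exists_reduced_module (hRX : ∀ T ∈ R, ∀ x ∈ X, T * x ∈ X)
    (inn : X → X →ₗ[ℂ] H →L[ℂ] H) :
    ∃ (V : Type) (_ : AddCommGroup V) (_ : Module ℂ V) (_ : Module R V)
      (_ : IsScalarTower ℂ R V) (mk : X →ₗ[ℂ] H →ₗ[ℂ] V) (Φ : X → V →ₗ[ℂ] H),
      (∀ x y h, Φ x (mk y h) = inn x y h) ∧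
      (∀ (T : R) (y : X) h, mk ⟨T * y, hRX T T.2 y y.2⟩ h = T • mk y h) ∧
      Submodule.span ℂ {w : V | ∃ y h, w = mk y h} = ⊤ ∧
      ∀ v, (∀ x, ∀ T : R, Φ x (T • v) = 0) → v = 0 := by
  let L : X → R →ₗ[ℂ] X := fun y =>
    { toFun := fun T => ⟨T * y, hRX T T.2 y y.2⟩
      map_add' := fun S T => Subtype.ext (add_mul _ _ _)
      map_smul' := fun c T => Subtype.ext (smul_mul_assoc _ _ _) }
  have L_add : ∀ y z T, L (y + z) T = L y T + L z T := fun y z T =>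
    Subtype.ext (mul_add _ _ _)
  have L_smul : ∀ (c : ℂ) y T, L (c • y) T = c • L y T := fun c y T =>
    Subtype.ext (mul_smul_comm _ _ _)
  let mk₀ : X →ₗ[ℂ] H →ₗ[ℂ] (X → R →ₗ[ℂ] H) := LinearMap.mk₂ ℂ
    (fun y h x => (ContinuousLinearMap.apply ℂ H h).toLinearMap ∘ₗ inn x ∘ₗ L y)
    (fun y z h => by ext x T; simp [L_add])
    (fun c y h => by ext x T; simp [L_smul])
    (fun y h k => by ext x T; simp)
    (fun c y h => by ext x T; simp)
  have mk₀_apply : ∀ y h x T, mk₀ y h x T = inn x (L y T) h := fun _ _ _ _ => rfl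
  let V : Submodule ℂ (X → R →ₗ[ℂ] H) := Submodule.span ℂ {w | ∃ y h, w = mk₀ y h}
  have hmem : ∀ y h, mk₀ y h ∈ V := fun y h => Submodule.subset_span ⟨y, h, rfl⟩
  have hact₀ : ∀ (S : R) y h,
      (fun x => mk₀ y h x ∘ₗ LinearMap.mulRight ℂ S) = mk₀ (L y S) h := by
    intro S y h
    ext x T
    simp only [LinearMap.comp_apply, LinearMap.mulRight_apply, mk₀_apply]
    congr 2
  have hact : ∀ (S : R) (u : X → R →ₗ[ℂ] H), u ∈ V →
      (fun x => u x ∘ₗ LinearMap.mulRight ℂ S) ∈ V := by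
    intro S u hu
    induction hu using Submodule.span_induction with
    | mem u hu =>
      obtain ⟨y, h, rfl⟩ := hu
      rw [hact₀]
      exact hmem _ _
    | zero => exact V.zero_mem
    | add u v _ _ hu hv => exact V.add_mem hu hv
    | smul c u _ hu => exact V.smul_mem c hu
  let instV : Module R V :=
    { smul := fun S u => ⟨fun x => u.1 x ∘ₗ LinearMap.mulRight ℂ S, hact S u.1 u.2⟩
      one_smul := fun u => by
        refine Subtype.ext (funext fun x => LinearMap.ext fun T => ?_)
        change u.1 x (T * 1) = u.1 x T
        rw [mul_one]
      mul_smul := fun S S' u => by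
        refine Subtype.ext (funext fun x => LinearMap.ext fun T => ?_)
        change u.1 x (T * (S * S')) = u.1 x (T * S * S')
        rw [mul_assoc]
      smul_zero := fun S => rfl
      smul_add := fun S u v => rfl
      add_smul := fun S S' u => by
        refine Subtype.ext (funext fun x => LinearMap.ext fun T => ?_)
        change u.1 x (T * (S + S')) = u.1 x (T * S) + u.1 x (T * S')
        rw [mul_add, map_add]
      zero_smul := fun u => by
        refine Subtype.ext (funext fun x => LinearMap.ext fun T => ?_)
        change u.1 x (T * 0) = 0
        rw [mul_zero, map_zero] }
  have smul_apply : ∀ (S : R) (u : V) x T, (S • u).1 x T = u.1 x (T * S) := fun _ _ _ _ => rfl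
  refine ⟨V, inferInstance, inferInstance, instV, ⟨fun c S u => ?_⟩,
    LinearMap.mk₂ ℂ (fun y h => (⟨mk₀ y h, hmem y h⟩ : V)) (fun _ _ _ => by ext; simp)
      (fun _ _ _ => by ext; simp) (fun _ _ _ => by ext; simp) (fun _ _ _ => by ext; simp),
    fun x => LinearMap.applyₗ (1 : R) ∘ₗ LinearMap.proj x ∘ₗ V.subtype,
    fun x y h => ?_, fun T y h => ?_, ?_, fun v hv => ?_⟩
  · refine Subtype.ext (funext fun x => LinearMap.ext fun T => ?_)
    change u.1 x (T * (c • S)) = c • u.1 x (T * S)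
    rw [mul_smul_comm, map_smul]
  · change inn x (L y 1) h = inn x y h
    congr 2
  · exact Subtype.ext (hact₀ T y h).symm
  · refine Eq.trans ?_ (Submodule.span_span_coe_preimage
      (R := ℂ) (s := {w : X → R →ₗ[ℂ] H | ∃ y h, w = mk₀ y h}))
    refine congrArg _ (Set.ext fun w => ?_)
    exact exists_congr fun y => exists_congr fun h => Subtype.ext_iff
  · refine Subtype.ext (funext fun x => LinearMap.ext fun T => ?_)
    have : v.1 x (1 * T) = 0 := hv x T
    rwa [one_mul] at this

end CyclicModule

section Factorization

variable {H : Type} [NormedAddCommGroup H] [InnerProductSpace ℂ H]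

lemma le_sq_mul_of_forall_gt {c A B : ℝ} (h : ∀ d, c < d → A ≤ d ^ 2 * B) : A ≤ c ^ 2 * B := by
  have hlim : Filter.Tendsto (fun d : ℝ => d ^ 2 * B) (nhdsWithin c (Set.Ioi c))
      (nhds (c ^ 2 * B)) :=
    ((continuous_pow 2).mul continuous_const).continuousAt.tendsto.mono_left nhdsWithin_le_nhds
  refine ge_of_tendsto hlim ?_
  filter_upwards [self_mem_nhdsWithin] with d hd using h d hd

/-- A quadratic estimate for contractive matrices extends to all matrices by homogeneity. -/
lemma le_sq_mul_of_matBound {ι Z : Type*} [Fintype ι] [AddCommGroup Z] [Module ℂ Z]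
    (j : Z →ₗ[ℂ] H →L[ℂ] H) (G : Matrix ι ι Z → ℝ)
    (hG : ∀ (r : ℝ) M, G ((r : ℂ) • M) = r ^ 2 * G M) {B : ℝ}
    (h1 : ∀ M, MatBound (fun k l => j (M k l)) 1 → G M ≤ B) {c : ℝ} (hc : 0 ≤ c)
    {M : Matrix ι ι Z} (hM : MatBound (fun k l => j (M k l)) c) : G M ≤ c ^ 2 * B := by
  refine le_sq_mul_of_forall_gt fun d hd => ?_
  have hd0 : 0 < d := hc.trans_lt hd
  have := h1 (((d⁻¹ : ℝ) : ℂ) • M) (by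
    have := (hM.mono hc hd.le).smul ((d⁻¹ : ℝ) : ℂ)
    rw [Complex.norm_real, Real.norm_of_nonneg (inv_nonneg.2 hd0.le), inv_mul_cancel₀ hd0.ne']
      at this
    simpa only [Matrix.smul_apply, map_smul] using this)
  rwa [hG, inv_pow, inv_mul_le_iff₀ (by positivity)] at this

lemma matBound_of_norm_le {E F : Type*} [NormedAddCommGroup E] [InnerProductSpace ℂ E]
    [NormedAddCommGroup F] [InnerProductSpace ℂ F] {T : E →L[ℂ] F} {c : ℝ} (hT : ‖T‖ ≤ c) :
    MatBound (fun _ _ : Unit => T) c := by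
  intro h
  have := pow_le_pow_left₀ (norm_nonneg _) (T.le_of_opNorm_le hT (h ())) 2
  simpa [mul_pow] using this

lemma exists_completion {V : Type} [AddCommGroup V] [Module ℂ V]
    (c : PreInnerProductSpace.Core ℂ V) :
    ∃ (K : Type) (_ : NormedAddCommGroup K) (_ : InnerProductSpace ℂ K) (_ : CompleteSpace K)
      (e : V →ₗ[ℂ] K), DenseRange e ∧ ∀ v, ‖e v‖ ^ 2 = (c.inner v v).re := by
  let _ : SeminormedAddCommGroup V := InnerProductSpace.Core.toSeminormedAddCommGroup (𝕜 := ℂ)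
  let _ : InnerProductSpace ℂ V := InnerProductSpace.ofCore c
  refine ⟨UniformSpace.Completion V, inferInstance, inferInstance, inferInstance,
    (UniformSpace.Completion.toComplₗᵢ (𝕜 := ℂ) (E := V)).toLinearMap,
    UniformSpace.Completion.denseRange_coe, fun v => ?_⟩
  change ‖(v : UniformSpace.Completion V)‖ ^ 2 = _
  rw [UniformSpace.Completion.norm_coe]
  exact InnerProductSpace.norm_sq_eq_re_inner (𝕜 := ℂ) v

lemma matBound_of_denseRange {ι κ V K F : Type*} [Fintype ι] [Fintype κ] [NormedAddCommGroup K]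
    [InnerProductSpace ℂ K] [NormedAddCommGroup F] [InnerProductSpace ℂ F] {e : V → K}
    (he : DenseRange e) {M : ι → κ → K →L[ℂ] F} {c : ℝ}
    (h : ∀ u : κ → V, ∑ i, ‖∑ k, M i k (e (u k))‖ ^ 2 ≤ c ^ 2 * ∑ k, ‖e (u k)‖ ^ 2) :
    MatBound M c := fun u =>
  (DenseRange.piMap fun _ : κ => he).induction_on
    (p := fun u => ∑ i, ‖∑ j, M i j (u j)‖ ^ 2 ≤ c ^ 2 * ∑ j, ‖u j‖ ^ 2) u
    (isClosed_le (by fun_prop) (by fun_prop)) h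

variable [CompleteSpace H] {X : Submodule ℂ (H →L[ℂ] H)} {R : Subalgebra ℂ (H →L[ℂ] H)}

set_option maxHeartbeats 1000000 in
/-- Factorization of an operator-valued sesquilinear pairing satisfying the matrix
Cauchy–Schwarz inequality through a Hilbert space carrying a representation of `R`. -/
theorem exists_factorization (hR : IsClosed (R : Set (H →L[ℂ] H)))
    (hRX : ∀ T ∈ R, ∀ x ∈ X, T * x ∈ X) (inn : X →ₗ⋆[ℂ] X →ₗ[ℂ] H →L[ℂ] H)
    (hCS : ∀ (ι : Type) [Fintype ι] (x y : Matrix ι ι X),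
      MatBound (fun i j => (x i j : H →L[ℂ] H)) 1 → MatBound (fun i j => (y i j : H →L[ℂ] H)) 1 →
      MatBound (fun i j => ∑ k, inn (x k i) (y k j)) 1) :
    ∃ (K : Type) (_ : NormedAddCommGroup K) (_ : InnerProductSpace ℂ K) (_ : CompleteSpace K)
      (x₁ : X →ₗ[ℂ] H →L[ℂ] K) (φ : X → K →L[ℂ] H) (α : R → K →L[ℂ] K),
      (∀ x y, φ x ∘L x₁ y = inn x y) ∧
      (∀ (T : R) (y : X), x₁ ⟨T * y, hRX T T.2 y y.2⟩ = α T ∘L x₁ y) ∧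
      Dense (Submodule.span ℂ {w : K | ∃ y h, w = x₁ y h} : Set K) ∧
      (∀ (y z : X) (b : H →L[ℂ] H), (∀ x (T : R), inn x ⟨T * y, hRX T T.2 y y.2⟩ ∘L b =
        inn x ⟨T * z, hRX T T.2 z z.2⟩) → x₁ y ∘L b = x₁ z) ∧
      ∀ (ι : Type) [Fintype ι] (c : ℝ), 0 ≤ c →
        (∀ y : Matrix ι ι X, MatBound (fun i j => (y i j : H →L[ℂ] H)) c →
          MatBound (fun i j => x₁ (y i j)) c) ∧
        (∀ x : Matrix ι ι X, MatBound (fun i j => (x i j : H →L[ℂ] H)) c →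
          MatBound (fun i k => φ (x k i)) c) ∧
        (∀ a : Matrix ι ι R, MatBound (fun i j => (a i j : H →L[ℂ] H)) c →
          MatBound (fun i j => α (a i j)) c) := by
  obtain ⟨V, _, _, _, _, mk, Φ, hΦmk, hmk, hspan, hsep⟩ :=
    exists_reduced_module hRX fun x => inn x
  have hΦsmul : ∀ (r : ℝ) x v, Φ ((r : ℂ) • x) v = (r : ℂ) • Φ x v := by
    intro r x v
    have : Φ ((r : ℂ) • x) = (r : ℂ) • Φ x := LinearMap.ext_on hspan (by
      rintro _ ⟨y, h, rfl⟩
      simp [hΦmk])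
    rw [this, LinearMap.smul_apply]
  obtain ⟨core, hcore⟩ := exists_preInnerProductSpace_core R hR mk Φ hRX hmk
    (fun ι _ y x hy hx h => by
      simp only [map_sum, hΦmk]
      have := hCS ι x y hx hy h
      simp only [sum_apply] at this
      rw [one_pow, one_mul] at this
      refine le_trans (le_of_eq (Finset.sum_congr rfl fun i _ => ?_)) this
      rw [Finset.sum_comm])
    (LinearMap.ext_on hspan (by rintro _ ⟨y, h, rfl⟩; simp [hΦmk])) hspan
  obtain ⟨K, _, _, _, e, he, hnorm⟩ := exists_completion core
  simp only [← hnorm] at hcore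
  have hmkb : ∀ (ι : Type) [Fintype ι] (c : ℝ), 0 ≤ c → ∀ y : Matrix ι ι X,
      MatBound (fun i j => (y i j : H →L[ℂ] H)) c → ∀ h : ι → H,
      ∑ i, ‖e (∑ j, mk (y i j) (h j))‖ ^ 2 ≤ c ^ 2 * ∑ j, ‖h j‖ ^ 2 := by
    intro ι _ c hc y hy h
    refine le_sq_mul_of_matBound X.subtype
      (fun y => ∑ i, ‖e (∑ j, mk (y i j) (h j))‖ ^ 2) (fun r y => ?_)
      (fun y hy => (hcore ι).1 y hy h) hc hy
    simp [← Finset.smul_sum, norm_smul, mul_pow, Finset.mul_sum]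
  have hΦb : ∀ (ι : Type) [Fintype ι] (c : ℝ), 0 ≤ c → ∀ x : Matrix ι ι X,
      MatBound (fun i j => (x i j : H →L[ℂ] H)) c → ∀ u : ι → V,
      ∑ i, ‖∑ k, Φ (x k i) (u k)‖ ^ 2 ≤ c ^ 2 * ∑ k, ‖e (u k)‖ ^ 2 := by
    intro ι _ c hc x hx u
    refine le_sq_mul_of_matBound X.subtype
      (fun x => ∑ i, ‖∑ k, Φ (x k i) (u k)‖ ^ 2) (fun r x => ?_)
      (fun x hx => (hcore ι).2.1 x hx u) hc hx
    simp only [Matrix.smul_apply, hΦsmul, ← Finset.smul_sum, norm_smul, mul_pow, ← Finset.mul_sum,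
      Complex.norm_real, Real.norm_eq_abs, sq_abs]
  have hRb : ∀ (ι : Type) [Fintype ι] (c : ℝ), 0 ≤ c → ∀ a : Matrix ι ι R,
      MatBound (fun i j => (a i j : H →L[ℂ] H)) c → ∀ v : ι → V,
      ∑ i, ‖e (∑ j, a i j • v j)‖ ^ 2 ≤ c ^ 2 * ∑ j, ‖e (v j)‖ ^ 2 := by
    intro ι _ c hc a ha v
    refine le_sq_mul_of_matBound R.val.toLinearMap
      (fun a => ∑ i, ‖e (∑ j, a i j • v j)‖ ^ 2) (fun r a => ?_)
      (fun a ha => (hcore ι).2.2 a ha v) hc ha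
    simp [← Finset.smul_sum, norm_smul, mul_pow, Finset.mul_sum, smul_assoc]
  have hmk1 : ∀ y h, ‖e (mk y h)‖ ≤ ‖y‖ * ‖h‖ := fun y h => by
    have := hmkb Unit ‖y‖ (norm_nonneg _) (fun _ _ => y) (matBound_of_norm_le le_rfl) fun _ => h
    refine le_of_sq_le_sq ?_ (by positivity)
    simpa [mul_pow] using this
  have hΦ1 : ∀ x v, ‖Φ x v‖ ≤ ‖x‖ * ‖e v‖ := fun x v => by
    have := hΦb Unit ‖x‖ (norm_nonneg _) (fun _ _ => x) (matBound_of_norm_le le_rfl) fun _ => v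
    refine le_of_sq_le_sq ?_ (by positivity)
    simpa [mul_pow] using this
  have hR1 : ∀ (T : R) v, ‖e (T • v)‖ ≤ ‖T‖ * ‖e v‖ := fun T v => by
    have := hRb Unit ‖T‖ (norm_nonneg _) (fun _ _ => T) (matBound_of_norm_le le_rfl) fun _ => v
    refine le_of_sq_le_sq ?_ (by positivity)
    simpa [mul_pow] using this
  let x₁ : X →ₗ[ℂ] H →L[ℂ] K :=
    { toFun := fun y => (e ∘ₗ mk y).mkContinuous ‖y‖ (hmk1 y)
      map_add' := fun y z => by ext h; simp
      map_smul' := fun c y => by ext h; simp }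
  have hx₁ : ∀ y h, x₁ y h = e (mk y h) := fun y h => rfl
  let φ : X → K →L[ℂ] H := fun x => (Φ x).extendOfNorm e
  have hφ : ∀ x v, φ x (e v) = Φ x v := fun x v =>
    LinearMap.extendOfNorm_eq he ⟨_, hΦ1 x⟩ v
  let α : R → K →L[ℂ] K := fun T => (e ∘ₗ DistribSMul.toLinearMap ℂ V T).extendOfNorm e
  have hα : ∀ T v, α T (e v) = e (T • v) := fun T v =>
    LinearMap.extendOfNorm_eq he ⟨_, hR1 T⟩ v
  refine ⟨K, _, _, ‹_›, x₁, φ, α, fun x y => ?_, fun T y => ?_, ?_, fun y z b h => ?_,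
    fun ι _ c hc => ⟨fun y hy h => ?_, fun x hx => ?_, fun a ha => ?_⟩⟩
  · ext h
    simp [hx₁, hφ, hΦmk]
  · ext h
    simp [hx₁, hα, hmk]
  · have : (Submodule.span ℂ {w : K | ∃ y h, w = x₁ y h} : Set K) = Set.range e := by
      rw [← LinearMap.coe_range, ← Submodule.map_top, ← hspan, Submodule.map_span]
      congr 2
      ext w
      constructor
      · rintro ⟨y, h, rfl⟩
        exact ⟨_, ⟨y, h, rfl⟩, rfl⟩
      · rintro ⟨_, ⟨y, h, rfl⟩, rfl⟩
        exact ⟨y, h, rfl⟩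
    rw [this]
    exact he
  · ext k
    rw [ContinuousLinearMap.comp_apply, hx₁, hx₁, sub_eq_zero.1 (hsep (mk y (b k) - mk z k) ?_)]
    intro x T
    have := congrArg (· k) (h x T)
    rw [smul_sub, ← hmk, ← hmk, map_sub, hΦmk, hΦmk, sub_eq_zero]
    exact this
  · have := hmkb ι c hc y hy h
    simpa only [map_sum, ← hx₁] using this
  · refine matBound_of_denseRange he fun u => ?_
    simpa only [hφ] using hΦb ι c hc x hx u
  · refine matBound_of_denseRange he fun v => ?_
    simpa only [hα, map_sum] using hRb ι c hc a ha v

end Factorization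

section Correspondence

variable {H : Type} [NormedAddCommGroup H] [InnerProductSpace ℂ H]

/-- The algebra of left multipliers of a space of operators. -/
def leftMultiplier (X : Submodule ℂ (H →L[ℂ] H)) : Subalgebra ℂ (H →L[ℂ] H) where
  carrier := {T | ∀ x ∈ X, T * x ∈ X}
  mul_mem' {S T} hS hT x hx := by
    rw [mul_assoc]
    exact hS _ (hT _ hx)
  add_mem' {S T} hS hT x hx := by
    rw [add_mul]
    exact X.add_mem (hS _ hx) (hT _ hx)
  algebraMap_mem' c x hx := by
    rw [← Algebra.smul_def]
    exact X.smul_mem c hx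

lemma isClosed_leftMultiplier {X : Submodule ℂ (H →L[ℂ] H)}
    (hX : IsClosed (X : Set (H →L[ℂ] H))) :
    IsClosed (leftMultiplier X : Set (H →L[ℂ] H)) := by
  have : (leftMultiplier X : Set (H →L[ℂ] H)) =
      ⋂ x ∈ X, (fun T : H →L[ℂ] H => T * x) ⁻¹' (X : Set (H →L[ℂ] H)) := by
    ext T
    simp [leftMultiplier]
  rw [this]
  exact isClosed_biInter fun x _ => hX.preimage (continuous_id.mul continuous_const)

/-- Factorization of the inner product of an operator `*`-correspondence through a Hilbert space
carrying representations of all the structure maps. -/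
theorem exists_correspondence_factorization [CompleteSpace H]
    (A B : NonUnitalSubalgebra ℂ (H →L[ℂ] H)) (dagA dagB : (H →L[ℂ] H) → (H →L[ℂ] H))
    (hdagA_mem : ∀ a ∈ A, dagA a ∈ A)
    (hdagB_mul : ∀ a ∈ B, ∀ b ∈ B, dagB (a * b) = dagB b * dagB a)
    (X : Submodule ℂ (H →L[ℂ] H)) (hX : IsClosed (X : Set (H →L[ℂ] H)))
    (hAX : ∀ a ∈ A, ∀ x ∈ X, a * x ∈ X) (hXB : ∀ x ∈ X, ∀ b ∈ B, x * b ∈ X)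
    (inn : (H →L[ℂ] H) → (H →L[ℂ] H) → (H →L[ℂ] H))
    (hinn_mem : ∀ x ∈ X, ∀ y ∈ X, inn x y ∈ B)
    (hinn_addl : ∀ x ∈ X, ∀ x' ∈ X, ∀ y ∈ X, inn (x + x') y = inn x y + inn x' y)
    (hinn_addr : ∀ x ∈ X, ∀ y ∈ X, ∀ y' ∈ X, inn x (y + y') = inn x y + inn x y')
    (hinn_smull : ∀ (c : ℂ), ∀ x ∈ X, ∀ y ∈ X, inn (c • x) y = conj c • inn x y)
    (hinn_smulr : ∀ (c : ℂ), ∀ x ∈ X, ∀ y ∈ X, inn x (c • y) = c • inn x y)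
    (hinn_right : ∀ x ∈ X, ∀ y ∈ X, ∀ b ∈ B, inn x (y * b) = inn x y * b)
    (hinn_herm : ∀ x ∈ X, ∀ y ∈ X, inn x y = dagB (inn y x))
    (hinn_adj : ∀ a ∈ A, ∀ x ∈ X, ∀ y ∈ X, inn (a * x) y = inn x (dagA a * y))
    (hinn_cs : ∀ (n : ℕ) (ξ η : Matrix (Fin n) (Fin n) (H →L[ℂ] H)),
      (∀ i j, ξ i j ∈ X) → (∀ i j, η i j ∈ X) →
      opMatNorm (Matrix.of fun i j => ∑ k, inn (ξ k i) (η k j)) ≤ opMatNorm ξ * opMatNorm η) :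
    ∃ (K : Type) (_ : NormedAddCommGroup K) (_ : InnerProductSpace ℂ K) (_ : CompleteSpace K)
      (x₁ : (H →L[ℂ] H) → H →L[ℂ] K) (φ : (H →L[ℂ] H) → K →L[ℂ] H)
      (α : (H →L[ℂ] H) → K →L[ℂ] K),
      (∀ x ∈ X, ∀ y ∈ X, x₁ (x + y) = x₁ x + x₁ y) ∧
      (∀ (c : ℂ), ∀ x ∈ X, x₁ (c • x) = c • x₁ x) ∧
      (∀ x ∈ X, ∀ y ∈ X, φ (x + y) = φ x + φ y) ∧
      (∀ (c : ℂ), ∀ x ∈ X, φ (c • x) = conj c • φ x) ∧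
      (∀ a ∈ A, ∀ b ∈ A, α (a + b) = α a + α b ∧ α (a * b) = α a * α b) ∧
      (∀ (c : ℂ), ∀ a ∈ A, α (c • a) = c • α a) ∧
      (∀ x ∈ X, ∀ y ∈ X, φ x ∘L x₁ y = inn x y) ∧
      (∀ a ∈ A, ∀ y ∈ X, x₁ (a * y) = α a ∘L x₁ y) ∧
      (∀ y ∈ X, ∀ b ∈ B, x₁ (y * b) = x₁ y ∘L b) ∧
      (∀ a ∈ A, ∀ x ∈ X, φ (a * x) = φ x ∘L α (dagA a)) ∧
      (∀ x ∈ X, ∀ b ∈ B, φ (x * b) = dagB b ∘L φ x) ∧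
      ∀ (n : ℕ) (c : ℝ), 0 ≤ c → ∀ M : Matrix (Fin n) (Fin n) (H →L[ℂ] H), MatBound M c →
        ((∀ i j, M i j ∈ X) → MatBound (fun i j => x₁ (M i j)) c) ∧
        ((∀ i j, M i j ∈ X) → MatBound (fun i j => φ (M j i)) c) ∧
        ((∀ i j, M i j ∈ A) → MatBound (fun i j => α (M i j)) c) := by
  classical
  let inn' : X →ₗ⋆[ℂ] X →ₗ[ℂ] H →L[ℂ] H := LinearMap.mk₂'ₛₗ (starRingEnd ℂ) (RingHom.id ℂ)
    (fun x y => inn x y) (fun x x' y => hinn_addl x x.2 x' x'.2 y y.2)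
    (fun c x y => hinn_smull c x x.2 y y.2) (fun x y y' => hinn_addr x x.2 y y.2 y' y'.2)
    (fun c x y => hinn_smulr c x x.2 y y.2)
  have hCS : ∀ (ι : Type) [Fintype ι] (x y : Matrix ι ι X),
      MatBound (fun i j => (x i j : H →L[ℂ] H)) 1 → MatBound (fun i j => (y i j : H →L[ℂ] H)) 1 →
      MatBound (fun i j => ∑ k, inn' (x k i) (y k j)) 1 := by
    intro ι _ x y hx hy
    let e := Fintype.equivFin ι
    let ξ : Matrix ι ι X → Matrix (Fin (Fintype.card ι)) (Fin (Fintype.card ι)) (H →L[ℂ] H) :=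
      fun z i j => z (e.symm i) (e.symm j)
    have hξ : ∀ z : Matrix ι ι X, MatBound (fun i j => (z i j : H →L[ℂ] H)) 1 →
        opMatNorm (ξ z) ≤ 1 := fun z hz =>
      (opMatNorm_le_iff _ zero_le_one).2 (hz.reindex e.symm e.symm)
    have h := (hinn_cs _ (ξ x) (ξ y) (fun _ _ => (x _ _).2) (fun _ _ => (y _ _).2)).trans
      (mul_le_mul (hξ x hx) (hξ y hy) (opMatNorm_nonneg _) zero_le_one)
    rw [one_mul, opMatNorm_le_iff _ zero_le_one] at h
    have h' := h.reindex e e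
    convert h' using 3 with i j
    simp only [ξ, Matrix.of_apply, Equiv.symm_apply_apply]
    exact (Equiv.sum_comp e.symm fun k => inn (x k i) (y k j)).symm
  obtain ⟨K, _, _, _, x₁, φ, α, hφx, hαx, hdense, hsep, hbound⟩ :=
    exists_factorization (isClosed_leftMultiplier hX) (fun T hT => hT) inn' hCS
  have hAR : ∀ a ∈ A, a ∈ leftMultiplier X := hAX
  have hext : ∀ {F : Type} [NormedAddCommGroup F] [NormedSpace ℂ F] (D E : K →L[ℂ] F),
      (∀ y, D ∘L x₁ y = E ∘L x₁ y) → D = E := by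
    intro F _ _ D E h
    refine ContinuousLinearMap.ext_on hdense ?_
    rintro _ ⟨y, k, rfl⟩
    exact congrArg (· k) (h y)
  let x₁' : (H →L[ℂ] H) → H →L[ℂ] K := fun x => if h : x ∈ X then x₁ ⟨x, h⟩ else 0
  let φ' : (H →L[ℂ] H) → K →L[ℂ] H := fun x => if h : x ∈ X then φ ⟨x, h⟩ else 0
  let α' : (H →L[ℂ] H) → K →L[ℂ] K :=
    fun a => if h : a ∈ leftMultiplier X then α ⟨a, h⟩ else 0
  have hx₁' : ∀ x : X, x₁' x = x₁ x := fun x => dif_pos x.2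
  have hφ' : ∀ x : X, φ' x = φ x := fun x => dif_pos x.2
  have hα' : ∀ a : leftMultiplier X, α' a = α a := fun a => dif_pos a.2
  have hφx' : ∀ x ∈ X, ∀ y : X, φ' x ∘L x₁ y = inn x y := fun x hx y => by
    rw [hφ' ⟨x, hx⟩, hφx]
    rfl
  have hαx' : ∀ (a) (ha : a ∈ A) (y : X),
      α' a ∘L x₁ y = x₁ ⟨a * y, hAX a ha y y.2⟩ := fun a ha y => by
    rw [hα' ⟨a, hAR a ha⟩, ← hαx]
  refine ⟨K, _, _, ‹_›, x₁', φ', α', fun x hx y hy => ?_, fun c x hx => ?_, fun x hx y hy => ?_,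
    fun c x hx => ?_, fun a ha b hb => ⟨?_, ?_⟩, fun c a ha => ?_, fun x hx y hy => ?_,
    fun a ha y hy => ?_, fun y hy b hb => ?_, fun a ha x hx => ?_, fun x hx b hb => ?_,
    fun n c hc M hM => ⟨fun h => ?_, fun h => ?_, fun h => ?_⟩⟩
  · rw [hx₁' ⟨x, hx⟩, hx₁' ⟨y, hy⟩, hx₁' ⟨x + y, X.add_mem hx hy⟩, ← map_add]
    rfl
  · rw [hx₁' ⟨x, hx⟩, hx₁' ⟨c • x, X.smul_mem c hx⟩, ← map_smul]
    rfl
  · refine hext _ _ fun z => ?_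
    rw [ContinuousLinearMap.add_comp, hφx' x hx, hφx' y hy, hφx' _ (X.add_mem hx hy),
      hinn_addl x hx y hy z z.2]
  · refine hext _ _ fun z => ?_
    rw [ContinuousLinearMap.smul_comp, hφx' x hx, hφx' _ (X.smul_mem c hx),
      hinn_smull c x hx z z.2]
  · refine hext _ _ fun z => ?_
    rw [ContinuousLinearMap.add_comp, hαx' a ha, hαx' b hb, hαx' _ (A.add_mem ha hb), ← map_add]
    exact congrArg x₁ (Subtype.ext (add_mul _ _ _))
  · refine hext _ _ fun z => ?_
    change α' (a * b) ∘L x₁ z = α' a ∘L (α' b ∘L x₁ z)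
    rw [hαx' b hb, hαx' a ha, hαx' _ (A.mul_mem ha hb)]
    exact congrArg x₁ (Subtype.ext (mul_assoc _ _ _))
  · refine hext _ _ fun z => ?_
    rw [ContinuousLinearMap.smul_comp, hαx' a ha, hαx' _ (A.smul_mem c ha), ← map_smul]
    exact congrArg x₁ (Subtype.ext (smul_mul_assoc _ _ _))
  · rw [hx₁' ⟨y, hy⟩, hφx' x hx]
  · rw [hx₁' ⟨y, hy⟩, hαx' a ha, ← hx₁']
  · rw [hx₁' ⟨y, hy⟩, hx₁' ⟨y * b, hXB y hy b hb⟩]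
    refine (hsep _ _ _ fun x T => ?_).symm
    change inn x (T * y) * b = inn x (T * (y * b))
    rw [← mul_assoc, hinn_right x x.2 _ (T.2 y hy) b hb]
  · refine hext _ _ fun z => ?_
    rw [ContinuousLinearMap.comp_assoc, hαx' _ (hdagA_mem a ha), hφx' x hx,
      hφx' _ (hAX a ha x hx), hinn_adj a ha x hx z z.2]
  · refine hext _ _ fun z => ?_
    rw [ContinuousLinearMap.comp_assoc, hφx' x hx, hφx' _ (hXB x hx b hb),
      hinn_herm _ (hXB x hx b hb) z z.2, hinn_right z z.2 x hx b hb,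
      hdagB_mul _ (hinn_mem z z.2 x hx) b hb, ← hinn_herm x hx z z.2]
    rfl
  · have := (hbound (Fin n) c hc).1 (fun i j => ⟨M i j, h i j⟩) hM
    simpa only [← hx₁'] using this
  · have := (hbound (Fin n) c hc).2.1 (fun i j => ⟨M i j, h i j⟩) hM
    simpa only [← hφ'] using this
  · have := (hbound (Fin n) c hc).2.2 (fun i j => ⟨M i j, hAR _ (h i j)⟩) hM
    simpa only [← hα'] using this

end Correspondence

section Block

variable {E F E' F' E'' F'' : Type*}
  [NormedAddCommGroup E] [InnerProductSpace ℂ E] [NormedAddCommGroup F] [InnerProductSpace ℂ F]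
  [NormedAddCommGroup E'] [InnerProductSpace ℂ E'] [NormedAddCommGroup F'] [InnerProductSpace ℂ F']
  [NormedAddCommGroup E''] [InnerProductSpace ℂ E'']
  [NormedAddCommGroup F''] [InnerProductSpace ℂ F'']

/-- The operator between orthogonal direct sums given by the block matrix `(a b; c d)`. -/
noncomputable def blockCLM (a : E →L[ℂ] E') (b : F →L[ℂ] E') (c : E →L[ℂ] F') (d : F →L[ℂ] F') :
    WithLp 2 (E × F) →L[ℂ] WithLp 2 (E' × F') :=
  ((WithLp.prodContinuousLinearEquiv 2 ℂ E' F').symm : E' × F' →L[ℂ] WithLp 2 (E' × F')) ∘L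
    ((a.coprod b).prod (c.coprod d)) ∘L
    (WithLp.prodContinuousLinearEquiv 2 ℂ E F : WithLp 2 (E × F) →L[ℂ] E × F)

lemma blockCLM_apply (a : E →L[ℂ] E') (b : F →L[ℂ] E') (c : E →L[ℂ] F') (d : F →L[ℂ] F')
    (z : WithLp 2 (E × F)) :
    blockCLM a b c d z = WithLp.toLp 2 (a z.fst + b z.snd, c z.fst + d z.snd) := rfl

lemma blockCLM_comp (a : E →L[ℂ] E') (b : F →L[ℂ] E') (c : E →L[ℂ] F') (d : F →L[ℂ] F')
    (a' : E' →L[ℂ] E'') (b' : F' →L[ℂ] E'') (c' : E' →L[ℂ] F'') (d' : F' →L[ℂ] F'') :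
    blockCLM a' b' c' d' ∘L blockCLM a b c d =
      blockCLM (a' ∘L a + b' ∘L c) (a' ∘L b + b' ∘L d) (c' ∘L a + d' ∘L c)
        (c' ∘L b + d' ∘L d) := by
  ext z
  simp only [blockCLM_apply, ContinuousLinearMap.comp_apply, add_apply, WithLp.toLp_fst,
    WithLp.toLp_snd, map_add]
  congr 2 <;> abel

lemma blockCLM_add (a : E →L[ℂ] E') (b : F →L[ℂ] E') (c : E →L[ℂ] F') (d : F →L[ℂ] F')
    (a' : E →L[ℂ] E') (b' : F →L[ℂ] E') (c' : E →L[ℂ] F') (d' : F →L[ℂ] F') :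
    blockCLM a b c d + blockCLM a' b' c' d' =
      blockCLM (a + a') (b + b') (c + c') (d + d') := by
  ext z
  simp only [blockCLM_apply, add_apply, ← WithLp.toLp_add, Prod.mk_add_mk]
  congr 2 <;> abel

lemma smul_blockCLM (t : ℂ) (a : E →L[ℂ] E') (b : F →L[ℂ] E') (c : E →L[ℂ] F')
    (d : F →L[ℂ] F') :
    t • blockCLM a b c d = blockCLM (t • a) (t • b) (t • c) (t • d) := by
  ext z
  simp only [blockCLM_apply, smul_apply, ← WithLp.toLp_smul, Prod.smul_mk,
    smul_add]

lemma adjoint_blockCLM [CompleteSpace E] [CompleteSpace F] [CompleteSpace E'] [CompleteSpace F']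
    (a : E →L[ℂ] E') (b : F →L[ℂ] E') (c : E →L[ℂ] F') (d : F →L[ℂ] F') :
    adjoint (blockCLM a b c d) = blockCLM (adjoint a) (adjoint c) (adjoint b) (adjoint d) := by
  symm
  rw [ContinuousLinearMap.eq_adjoint_iff]
  intro x y
  simp only [blockCLM_apply, WithLp.prod_inner_apply, WithLp.ofLp_fst, WithLp.ofLp_snd,
    inner_add_left, inner_add_right, ContinuousLinearMap.adjoint_inner_left]
  abel

lemma norm_toLp_prod_sq {E F : Type*} [NormedAddCommGroup E] [NormedAddCommGroup F] (z : E × F) :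
    ‖WithLp.toLp 2 z‖ ^ 2 = ‖z.1‖ ^ 2 + ‖z.2‖ ^ 2 :=
  WithLp.prod_norm_sq_eq_of_L2 _

variable {ι κ : Type*} [Fintype ι] [Fintype κ]

lemma MatBound.blockCLM_column {a : ι → κ → E →L[ℂ] E'} {c : ι → κ → E →L[ℂ] F'} {r s t : ℝ}
    (ha : MatBound a r) (hc : MatBound c s) (hrs : r ^ 2 + s ^ 2 ≤ t ^ 2) :
    MatBound (fun i j => (blockCLM (a i j) 0 (c i j) 0 :
      WithLp 2 (E × F) →L[ℂ] WithLp 2 (E' × F'))) t := by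
  intro h
  have key : ∀ i, ‖∑ j, (blockCLM (a i j) 0 (c i j) 0 :
      WithLp 2 (E × F) →L[ℂ] WithLp 2 (E' × F')) (h j)‖ ^ 2 =
      ‖∑ j, a i j (h j).fst‖ ^ 2 + ‖∑ j, c i j (h j).fst‖ ^ 2 := fun i => by
    simp only [blockCLM_apply, zero_apply, add_zero, ← WithLp.toLp_sum,
      norm_toLp_prod_sq, Prod.fst_sum, Prod.snd_sum]
  simp only [key, Finset.sum_add_distrib]
  have h1 : ∑ j, ‖(h j).fst‖ ^ 2 ≤ ∑ j, ‖h j‖ ^ 2 := Finset.sum_le_sum fun j _ => by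
    rw [WithLp.prod_norm_sq_eq_of_L2 (h j)]
    exact le_add_of_nonneg_right (sq_nonneg _)
  calc _ ≤ r ^ 2 * ∑ j, ‖(h j).fst‖ ^ 2 + s ^ 2 * ∑ j, ‖(h j).fst‖ ^ 2 :=
        add_le_add (ha fun j => (h j).fst) (hc fun j => (h j).fst)
    _ = (r ^ 2 + s ^ 2) * ∑ j, ‖(h j).fst‖ ^ 2 := by ring
    _ ≤ t ^ 2 * ∑ j, ‖h j‖ ^ 2 := by gcongr

lemma MatBound.blockCLM_diagonal {a : ι → κ → E →L[ℂ] E'} {d : ι → κ → F →L[ℂ] F'} {t : ℝ}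
    (ha : MatBound a t) (hd : MatBound d t) :
    MatBound (fun i j => blockCLM (a i j) 0 0 (d i j)) t := by
  intro h
  have key : ∀ i, ‖∑ j, blockCLM (a i j) 0 0 (d i j) (h j)‖ ^ 2 =
      ‖∑ j, a i j (h j).fst‖ ^ 2 + ‖∑ j, d i j (h j).snd‖ ^ 2 := fun i => by
    simp only [blockCLM_apply, zero_apply, add_zero, zero_add, ← WithLp.toLp_sum,
      norm_toLp_prod_sq, Prod.fst_sum, Prod.snd_sum]
  simp only [key, WithLp.prod_norm_sq_eq_of_L2, Finset.sum_add_distrib, mul_add]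
  exact add_le_add (ha fun j => (h j).fst) (hd fun j => (h j).snd)

lemma MatBound.of_blockCLM {a : ι → κ → E →L[ℂ] E'} {c : ι → κ → E →L[ℂ] F'}
    {d : ι → κ → F →L[ℂ] F'} {t : ℝ}
    (h : MatBound (fun i j => blockCLM (a i j) 0 (c i j) (d i j)) t) : MatBound a t := by
  intro g
  have h' := h fun j => WithLp.toLp 2 (g j, 0)
  simp only [norm_toLp_prod_sq, blockCLM_apply, ← WithLp.toLp_sum, Prod.fst_sum, Prod.snd_sum,
    zero_apply, add_zero, norm_zero, ne_eq, OfNat.ofNat_ne_zero,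
    not_false_eq_true, zero_pow] at h'
  refine (Finset.sum_le_sum fun i _ => ?_).trans h'
  exact le_add_of_nonneg_right (sq_nonneg _)

lemma opMatNorm_map_blockCLM_le {S : Type*} (M : Matrix ι ι S) {ρ : S → E →L[ℂ] E}
    {σ : S → F →L[ℂ] F} {t : ℝ} (ht : 0 ≤ t) (hρ : MatBound (fun i j => ρ (M i j)) t)
    (hσ : MatBound (fun i j => σ (M i j)) t) :
    opMatNorm (M.map fun s => blockCLM (ρ s) 0 0 (σ s)) ≤ t :=
  (opMatNorm_le_iff _ ht).2 (hρ.blockCLM_diagonal hσ)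

lemma matBound_opMatNorm_map_blockCLM {S : Type*} (M : Matrix ι ι S) (ρ : S → E →L[ℂ] E)
    (σ : S → F →L[ℂ] F) :
    MatBound (fun i j => ρ (M i j)) (opMatNorm (M.map fun s => blockCLM (ρ s) 0 0 (σ s))) :=
  (matBound_opMatNorm (M.map fun s => blockCLM (ρ s) 0 0 (σ s))).of_blockCLM

end Block

/-- **Existence of a standard form representation for concrete operator `*`-correspondences**
(Theorem 5.8). Let `𝒜, ℬ ⊆ B(H₀)` be closed subalgebras with completely isometric involutions
and let `𝒳 ⊆ B(H₀)` be a closed `𝒜`-`ℬ`-subbimodule with a `ℬ`-valued inner product satisfying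
the matrix Cauchy–Schwarz inequality. Then there are a Hilbert space `H_π`, completely isometric
algebra homomorphisms `π_𝒜`, `π_ℬ`, a `√2`-cb-embedding `π_𝒳` and a self-adjoint unitary `U`
implementing the involutions and the inner product. -/
theorem operator_star_correspondence_standard_form
    (H₀ : Type) [NormedAddCommGroup H₀] [InnerProductSpace ℂ H₀] [CompleteSpace H₀]
    (A B : NonUnitalSubalgebra ℂ (H₀ →L[ℂ] H₀))
    (hA : IsClosed (A : Set (H₀ →L[ℂ] H₀))) (hB : IsClosed (B : Set (H₀ →L[ℂ] H₀)))
    -- the completely isometric involution on `𝒜`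
    (dagA : (H₀ →L[ℂ] H₀) → (H₀ →L[ℂ] H₀))
    (hdagA_mem : ∀ a ∈ A, dagA a ∈ A)
    (hdagA_add : ∀ a ∈ A, ∀ b ∈ A, dagA (a + b) = dagA a + dagA b)
    (hdagA_smul : ∀ (c : ℂ), ∀ a ∈ A, dagA (c • a) = conj c • dagA a)
    (hdagA_mul : ∀ a ∈ A, ∀ b ∈ A, dagA (a * b) = dagA b * dagA a)
    (hdagA_invol : ∀ a ∈ A, dagA (dagA a) = a)
    (hdagA_iso : ∀ (n : ℕ) (x : Matrix (Fin n) (Fin n) (H₀ →L[ℂ] H₀)), (∀ i j, x i j ∈ A) →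
      opMatNorm (Matrix.of fun i j => dagA (x j i)) = opMatNorm x)
    -- the completely isometric involution on `ℬ`
    (dagB : (H₀ →L[ℂ] H₀) → (H₀ →L[ℂ] H₀))
    (hdagB_mem : ∀ b ∈ B, dagB b ∈ B)
    (hdagB_add : ∀ a ∈ B, ∀ b ∈ B, dagB (a + b) = dagB a + dagB b)
    (hdagB_smul : ∀ (c : ℂ), ∀ b ∈ B, dagB (c • b) = conj c • dagB b)
    (hdagB_mul : ∀ a ∈ B, ∀ b ∈ B, dagB (a * b) = dagB b * dagB a)
    (hdagB_invol : ∀ b ∈ B, dagB (dagB b) = b)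
    (hdagB_iso : ∀ (n : ℕ) (x : Matrix (Fin n) (Fin n) (H₀ →L[ℂ] H₀)), (∀ i j, x i j ∈ B) →
      opMatNorm (Matrix.of fun i j => dagB (x j i)) = opMatNorm x)
    -- `𝒳` is a closed `𝒜`-`ℬ`-subbimodule of `B(H₀)`
    (𝒳 : Submodule ℂ (H₀ →L[ℂ] H₀)) (h𝒳 : IsClosed (𝒳 : Set (H₀ →L[ℂ] H₀)))
    (hA𝒳 : ∀ a ∈ A, ∀ x ∈ 𝒳, a * x ∈ 𝒳)
    (h𝒳B : ∀ x ∈ 𝒳, ∀ b ∈ B, x * b ∈ 𝒳)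
    -- the `ℬ`-valued pairing on `𝒳`
    (inn : (H₀ →L[ℂ] H₀) → (H₀ →L[ℂ] H₀) → (H₀ →L[ℂ] H₀))
    (hinn_mem : ∀ x ∈ 𝒳, ∀ y ∈ 𝒳, inn x y ∈ B)
    (hinn_addl : ∀ x ∈ 𝒳, ∀ x' ∈ 𝒳, ∀ y ∈ 𝒳, inn (x + x') y = inn x y + inn x' y)
    (hinn_addr : ∀ x ∈ 𝒳, ∀ y ∈ 𝒳, ∀ y' ∈ 𝒳, inn x (y + y') = inn x y + inn x y')
    (hinn_smull : ∀ (c : ℂ), ∀ x ∈ 𝒳, ∀ y ∈ 𝒳, inn (c • x) y = conj c • inn x y)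
    (hinn_smulr : ∀ (c : ℂ), ∀ x ∈ 𝒳, ∀ y ∈ 𝒳, inn x (c • y) = c • inn x y)
    (hinn_right : ∀ x ∈ 𝒳, ∀ y ∈ 𝒳, ∀ b ∈ B, inn x (y * b) = inn x y * b)
    (hinn_herm : ∀ x ∈ 𝒳, ∀ y ∈ 𝒳, inn x y = dagB (inn y x))
    (hinn_adj : ∀ a ∈ A, ∀ x ∈ 𝒳, ∀ y ∈ 𝒳, inn (a * x) y = inn x (dagA a * y))
    (hinn_cs : ∀ (n : ℕ) (ξ η : Matrix (Fin n) (Fin n) (H₀ →L[ℂ] H₀)),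
      (∀ i j, ξ i j ∈ 𝒳) → (∀ i j, η i j ∈ 𝒳) →
      opMatNorm (Matrix.of fun i j => ∑ k, inn (ξ k i) (η k j)) ≤ opMatNorm ξ * opMatNorm η) :
    ∃ (Hπ : Type) (_ : NormedAddCommGroup Hπ) (_ : InnerProductSpace ℂ Hπ) (_ : CompleteSpace Hπ)
      (πA πB πX : (H₀ →L[ℂ] H₀) → (Hπ →L[ℂ] Hπ)) (U : Hπ →L[ℂ] Hπ),
      -- `U` is a self-adjoint unitary
      ContinuousLinearMap.adjoint U = U ∧ U * U = 1 ∧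
      -- `π_𝒜` and `π_ℬ` are algebra homomorphisms
      (∀ a ∈ A, ∀ a' ∈ A, πA (a + a') = πA a + πA a' ∧ πA (a * a') = πA a * πA a') ∧
      (∀ (c : ℂ), ∀ a ∈ A, πA (c • a) = c • πA a) ∧
      (∀ b ∈ B, ∀ b' ∈ B, πB (b + b') = πB b + πB b' ∧ πB (b * b') = πB b * πB b') ∧
      (∀ (c : ℂ), ∀ b ∈ B, πB (c • b) = c • πB b) ∧
      -- `π_𝒳` is linear
      (∀ x ∈ 𝒳, ∀ x' ∈ 𝒳, πX (x + x') = πX x + πX x') ∧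
      (∀ (c : ℂ), ∀ x ∈ 𝒳, πX (c • x) = c • πX x) ∧
      -- (1) `π_𝒜` and `π_ℬ` are completely isometric and `π_𝒳` satisfies the `√2`-estimates
      (∀ (n : ℕ) (a : Matrix (Fin n) (Fin n) (H₀ →L[ℂ] H₀)), (∀ i j, a i j ∈ A) →
        opMatNorm (a.map πA) = opMatNorm a) ∧
      (∀ (n : ℕ) (b : Matrix (Fin n) (Fin n) (H₀ →L[ℂ] H₀)), (∀ i j, b i j ∈ B) →
        opMatNorm (b.map πB) = opMatNorm b) ∧
      (∀ (n : ℕ) (x : Matrix (Fin n) (Fin n) (H₀ →L[ℂ] H₀)), (∀ i j, x i j ∈ 𝒳) →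
        opMatNorm x ≤ opMatNorm (x.map πX) ∧
          opMatNorm (x.map πX) ≤ Real.sqrt 2 * opMatNorm x) ∧
      -- (2) the module relations
      (∀ x ∈ 𝒳, ∀ b ∈ B, πX (x * b) = πX x * πB b) ∧
      (∀ a ∈ A, ∀ x ∈ 𝒳, πA a * πX x = πX (a * x)) ∧
      -- (3) `U` implements the involutions
      (∀ a ∈ A, U * ContinuousLinearMap.adjoint (πA a) * U = πA (dagA a)) ∧
      (∀ b ∈ B, U * ContinuousLinearMap.adjoint (πB b) * U = πB (dagB b)) ∧
      -- (4) `U` implements the inner product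
      (∀ x ∈ 𝒳, ∀ y ∈ 𝒳,
        U * ContinuousLinearMap.adjoint (πX x) * U * πX y = πB (inn x y)) := by
  obtain ⟨K, _, _, _, x₁, φ, α, hx_add, hx_smul, hφ_add, hφ_smul, hα_hom, hα_smul, hφx, hαx, hxb,
    hφa, hφb, hbd⟩ := exists_correspondence_factorization A B dagA dagB hdagA_mem hdagB_mul 𝒳 h𝒳
      hA𝒳 h𝒳B inn hinn_mem hinn_addl hinn_addr hinn_smull hinn_smulr hinn_right hinn_herm hinn_adj
      hinn_cs
  let α' : (H₀ →L[ℂ] H₀) → WithLp 2 (H₀ × K) →L[ℂ] WithLp 2 (H₀ × K) :=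
    fun a => blockCLM a 0 0 (α a)
  let β' : (H₀ →L[ℂ] H₀) → WithLp 2 (H₀ × K) →L[ℂ] WithLp 2 (H₀ × K) :=
    fun b => blockCLM b 0 0 0
  let ξ₁ : (H₀ →L[ℂ] H₀) → WithLp 2 (H₀ × K) →L[ℂ] WithLp 2 (H₀ × K) :=
    fun x => blockCLM x 0 (x₁ x) 0
  let ξ₂ : (H₀ →L[ℂ] H₀) → WithLp 2 (H₀ × K) →L[ℂ] WithLp 2 (H₀ × K) :=
    fun x => blockCLM 0 0 (adjoint (φ x)) 0
  have hα'_add : ∀ a ∈ A, ∀ b ∈ A, α' (a + b) = α' a + α' b := fun a ha b hb => by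
    simp only [α', blockCLM_add, (hα_hom a ha b hb).1, add_zero]
  have hα'_mul : ∀ a ∈ A, ∀ b ∈ A, α' (a * b) = α' a ∘L α' b := fun a ha b hb => by
    simp only [α', blockCLM_comp, (hα_hom a ha b hb).2, add_zero, zero_add, comp_zero, zero_comp]
    rfl
  have hα'_smul : ∀ (c : ℂ), ∀ a ∈ A, α' (c • a) = c • α' a := fun c a ha => by
    simp only [α', smul_blockCLM, hα_smul c a ha, smul_zero]
  have hβ'_add : ∀ a b, β' (a + b) = β' a + β' b := fun a b => by
    simp only [β', blockCLM_add, add_zero]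
  have hβ'_mul : ∀ a b, β' (a * b) = β' a ∘L β' b := fun a b => by
    simp only [β', blockCLM_comp, add_zero, comp_zero, zero_comp, ContinuousLinearMap.mul_def]
  have hβ'_smul : ∀ (c : ℂ) a, β' (c • a) = c • β' a := fun c a => by
    simp only [β', smul_blockCLM, smul_zero]
  have hξ₁_add : ∀ x ∈ 𝒳, ∀ y ∈ 𝒳, ξ₁ (x + y) = ξ₁ x + ξ₁ y := fun x hx y hy => by
    simp only [ξ₁, blockCLM_add, hx_add x hx y hy, add_zero]
  have hξ₁_smul : ∀ (c : ℂ), ∀ x ∈ 𝒳, ξ₁ (c • x) = c • ξ₁ x := fun c x hx => by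
    simp only [ξ₁, smul_blockCLM, hx_smul c x hx, smul_zero]
  have hξ₂_add : ∀ x ∈ 𝒳, ∀ y ∈ 𝒳, ξ₂ (x + y) = ξ₂ x + ξ₂ y := fun x hx y hy => by
    simp only [ξ₂, blockCLM_add, hφ_add x hx y hy, add_zero, map_add]
  have hξ₂_smul : ∀ (c : ℂ), ∀ x ∈ 𝒳, ξ₂ (c • x) = c • ξ₂ x := fun c x hx => by
    simp only [ξ₂, smul_blockCLM, hφ_smul c x hx, smul_zero, map_smulₛₗ, RCLike.conj_conj]
  have hξ₁_right : ∀ x ∈ 𝒳, ∀ b ∈ B, ξ₁ (x * b) = ξ₁ x ∘L β' b := fun x hx b hb => by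
    simp only [ξ₁, β', blockCLM_comp, hxb x hx b hb, add_zero, comp_zero]
    rfl
  have hξ₂_right : ∀ x ∈ 𝒳, ∀ b ∈ B, ξ₂ (x * b) = ξ₂ x ∘L adjoint (β' (dagB b)) :=
    fun x hx b hb => by
    simp only [ξ₂, β', adjoint_blockCLM, blockCLM_comp, hφb x hx b hb, add_zero, comp_zero,
      zero_comp, map_zero, ContinuousLinearMap.adjoint_comp]
  have hξ₁_left : ∀ a ∈ A, ∀ x ∈ 𝒳, α' a ∘L ξ₁ x = ξ₁ (a * x) := fun a ha x hx => by
    simp only [ξ₁, α', blockCLM_comp, hαx a ha x hx, add_zero, zero_add, comp_zero, zero_comp]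
    rfl
  have hξ₂_left : ∀ a ∈ A, ∀ x ∈ 𝒳, adjoint (α' (dagA a)) ∘L ξ₂ x = ξ₂ (a * x) :=
    fun a ha x hx => by
    simp only [ξ₂, α', adjoint_blockCLM, blockCLM_comp, hφa a ha x hx, add_zero, zero_add,
      comp_zero, zero_comp, map_zero, ContinuousLinearMap.adjoint_comp]
  have hξ₂ξ₁ : ∀ x ∈ 𝒳, ∀ y ∈ 𝒳, adjoint (ξ₂ x) ∘L ξ₁ y = β' (inn x y) := fun x hx y hy => by
    simp only [ξ₁, ξ₂, β', adjoint_blockCLM, blockCLM_comp, hφx x hx y hy, add_zero, zero_add,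
      comp_zero, zero_comp, map_zero, ContinuousLinearMap.adjoint_adjoint]
  have hξ₁ξ₂ : ∀ x ∈ 𝒳, ∀ y ∈ 𝒳, adjoint (ξ₁ x) ∘L ξ₂ y = adjoint (β' (inn y x)) :=
    fun x hx y hy => by
    rw [← hξ₂ξ₁ y hy x hx, ContinuousLinearMap.adjoint_comp, ContinuousLinearMap.adjoint_adjoint]
  refine ⟨WithLp 2 (WithLp 2 (H₀ × K) × WithLp 2 (H₀ × K)), inferInstance, inferInstance,
    inferInstance,
    fun a => blockCLM (α' a) 0 0 (adjoint (α' (dagA a))),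
    fun b => blockCLM (β' b) 0 0 (adjoint (β' (dagB b))),
    fun x => blockCLM (ξ₁ x) 0 0 (ξ₂ x),
    blockCLM 0 (.id ℂ _) (.id ℂ _) 0, ?_, ?_, fun a ha b hb => ⟨?_, ?_⟩, fun c a ha => ?_,
    fun a ha b hb => ⟨?_, ?_⟩, fun c b hb => ?_, fun x hx y hy => ?_, fun c x hx => ?_,
    fun n a ha => ?_, fun n b hb => ?_, fun n x hx => ⟨?_, ?_⟩, fun x hx b hb => ?_,
    fun a ha x hx => ?_, fun a ha => ?_, fun b hb => ?_, fun x hx y hy => ?_⟩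
  · simp only [adjoint_blockCLM, ContinuousLinearMap.adjoint_id, map_zero]
  · ext z
    simp only [blockCLM_apply, ContinuousLinearMap.mul_def, ContinuousLinearMap.comp_apply,
      ContinuousLinearMap.id_apply, zero_apply, zero_add, add_zero]
    rfl
  · simp only [blockCLM_add, hα'_add a ha b hb, hdagA_add a ha b hb,
      hα'_add _ (hdagA_mem a ha) _ (hdagA_mem b hb), map_add, add_zero]
  · simp only [ContinuousLinearMap.mul_def, blockCLM_comp, add_zero, zero_add, comp_zero,
      zero_comp]
    rw [← ContinuousLinearMap.mul_def a b, hα'_mul a ha b hb, hdagA_mul a ha b hb,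
      hα'_mul _ (hdagA_mem b hb) _ (hdagA_mem a ha), ContinuousLinearMap.adjoint_comp]
  · simp only [smul_blockCLM, hα'_smul c a ha, hdagA_smul c a ha,
      hα'_smul _ _ (hdagA_mem a ha), map_smulₛₗ, RCLike.conj_conj, smul_zero]
  · simp only [blockCLM_add, hβ'_add, hdagB_add a ha b hb, map_add, add_zero]
  · simp only [ContinuousLinearMap.mul_def, blockCLM_comp, add_zero, zero_add, comp_zero,
      zero_comp]
    rw [← ContinuousLinearMap.mul_def a b, hβ'_mul, hdagB_mul a ha b hb, hβ'_mul,
      ContinuousLinearMap.adjoint_comp]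
  · simp only [smul_blockCLM, hβ'_smul, hdagB_smul c b hb, map_smulₛₗ, RCLike.conj_conj, smul_zero]
  · simp only [blockCLM_add, hξ₁_add x hx y hy, hξ₂_add x hx y hy, add_zero]
  · simp only [smul_blockCLM, hξ₁_smul c x hx, hξ₂_smul c x hx, smul_zero]
  · have hα'_bound : ∀ (c : ℝ), 0 ≤ c → ∀ a : Matrix (Fin n) (Fin n) (H₀ →L[ℂ] H₀),
        (∀ i j, a i j ∈ A) → MatBound a c → MatBound (fun i j => α' (a i j)) c :=
      fun c hc a ha hac => hac.blockCLM_diagonal ((hbd n c hc a hac).2.2 ha)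
    refine le_antisymm ?_ ?_
    · refine opMatNorm_map_blockCLM_le a (opMatNorm_nonneg _) ?_ ?_
      · exact hα'_bound _ (opMatNorm_nonneg _) a ha (matBound_opMatNorm a)
      · rw [← hdagA_iso n a ha]
        exact (hα'_bound _ (opMatNorm_nonneg _) _ (fun i j => hdagA_mem _ (ha j i))
          (matBound_opMatNorm _)).adjoint
    · exact (opMatNorm_le_iff _ (opMatNorm_nonneg _)).2
        (matBound_opMatNorm_map_blockCLM a α' fun s => adjoint (α' (dagA s))).of_blockCLM
  · have hβ'_bound : ∀ (c : ℝ) (b : Matrix (Fin n) (Fin n) (H₀ →L[ℂ] H₀)),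
        0 ≤ c → MatBound b c → MatBound (fun i j => β' (b i j)) c :=
      fun c b hc hbc => hbc.blockCLM_diagonal (MatBound.zero.mono le_rfl hc)
    refine le_antisymm ?_ ?_
    · refine opMatNorm_map_blockCLM_le b (opMatNorm_nonneg _) ?_ ?_
      · exact hβ'_bound _ b (opMatNorm_nonneg _) (matBound_opMatNorm b)
      · rw [← hdagB_iso n b hb]
        exact (hβ'_bound _ _ (opMatNorm_nonneg _) (matBound_opMatNorm _)).adjoint
    · exact (opMatNorm_le_iff _ (opMatNorm_nonneg _)).2
        (matBound_opMatNorm_map_blockCLM b β' fun s => adjoint (β' (dagB s))).of_blockCLM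
  · exact (opMatNorm_le_iff _ (opMatNorm_nonneg _)).2
      (matBound_opMatNorm_map_blockCLM x ξ₁ ξ₂).of_blockCLM
  · have hx0 := opMatNorm_nonneg x
    have hxx := matBound_opMatNorm x
    have hsq : (Real.sqrt 2 * opMatNorm x) ^ 2 = 2 * opMatNorm x ^ 2 := by
      rw [mul_pow, Real.sq_sqrt zero_le_two]
    refine opMatNorm_map_blockCLM_le x (by positivity) ?_ ?_
    · refine hxx.blockCLM_column ((hbd n _ hx0 x hxx).1 hx) ?_
      rw [hsq, two_mul]
    · refine (MatBound.zero.mono le_rfl hx0).blockCLM_column ((hbd n _ hx0 x hxx).2.1 hx).adjoint ?_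
      rw [hsq]
      nlinarith [sq_nonneg (opMatNorm x)]
  · simp only [ContinuousLinearMap.mul_def, blockCLM_comp, add_zero, zero_add, comp_zero,
      zero_comp]
    rw [← ContinuousLinearMap.mul_def x b, hξ₁_right x hx b hb, hξ₂_right x hx b hb]
  · simp only [ContinuousLinearMap.mul_def, blockCLM_comp, add_zero, zero_add, comp_zero,
      zero_comp]
    rw [← ContinuousLinearMap.mul_def a x, hξ₁_left a ha x hx, hξ₂_left a ha x hx]
  · simp only [ContinuousLinearMap.mul_def, adjoint_blockCLM, blockCLM_comp, add_zero, zero_add,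
      comp_zero, zero_comp, map_zero, ContinuousLinearMap.id_comp, ContinuousLinearMap.comp_id,
      ContinuousLinearMap.adjoint_adjoint, hdagA_invol a ha]
  · simp only [ContinuousLinearMap.mul_def, adjoint_blockCLM, blockCLM_comp, add_zero, zero_add,
      comp_zero, zero_comp, map_zero, ContinuousLinearMap.id_comp, ContinuousLinearMap.comp_id,
      ContinuousLinearMap.adjoint_adjoint, hdagB_invol b hb]
  · simp only [ContinuousLinearMap.mul_def, adjoint_blockCLM, blockCLM_comp, add_zero, zero_add,
      comp_zero, zero_comp, map_zero, ContinuousLinearMap.id_comp, ContinuousLinearMap.comp_id,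
      hξ₂ξ₁ x hx y hy, hξ₁ξ₂ x hx y hy, ← hinn_herm y hy x hx]
end
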